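/- arXiv:2410.19919 — 8 statements merged into one kernel-verified Lean document; each statement's English description precedes it below -/
import Mathlib

section
/- Let S be a measurable space and let κ be a Markov kernel on S (a measurable assignment s ↦ κ(s) of probability measures on S). Suppose κ satisfies the Doeblin condition with coefficient α ∈ (0,1), i.e. ‖κ(s) − κ(s′)‖_TV ≤ 2α for all s, s′ ∈ S. Then for any two probability measures μ₁, μ₂ on S and every t ∈ ℕ, the t-step distributions satisfy ‖μ₁κ^t − μ₂κ^t‖_TV ≤ α^t · ‖μ₁ − μ₂‖_TV. -/
open MeasureTheory

/-- Total variation distance between two measures: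
`‖μ − ν‖_TV = 2 · sup {|μ(B) − ν(B)| : B measurable}`. -/
noncomputable def tvDist {S : Type*} [MeasurableSpace S] (μ ν : Measure S) : ℝ :=
  2 * ⨆ B : {B : Set S // MeasurableSet B}, |(μ B.1).toReal - (ν B.1).toReal|

/-- `stepIter κ t μ` is the `t`-step distribution `μ κ^t`, the `t`-fold
iterate of `μ ↦ bind μ κ` applied to `μ`. -/
noncomputable def stepIter {S : Type*} [MeasurableSpace S]
    (κ : S → Measure S) (t : ℕ) (μ : Measure S) : Measure S :=
  (fun m => m.bind κ)^[t] μ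

lemma bddAbove_tvDist_range {S : Type*} [MeasurableSpace S] (μ ν : Measure S)
    [IsProbabilityMeasure μ] [IsProbabilityMeasure ν] :
    BddAbove (Set.range fun B : {B : Set S // MeasurableSet B} =>
      |(μ B.1).toReal - (ν B.1).toReal|) := by
  refine ⟨1, ?_⟩
  rintro _ ⟨B, rfl⟩
  have h₁ : (μ B.1).toReal ≤ 1 := measureReal_le_one
  have h₂ : (ν B.1).toReal ≤ 1 := measureReal_le_one
  have h₃ : 0 ≤ (μ B.1).toReal := ENNReal.toReal_nonneg
  have h₄ : 0 ≤ (ν B.1).toReal := ENNReal.toReal_nonneg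
  exact abs_le.2 ⟨by linarith, by linarith⟩

lemma two_mul_abs_sub_le_tvDist {S : Type*} [MeasurableSpace S] (μ ν : Measure S)
    [IsProbabilityMeasure μ] [IsProbabilityMeasure ν] {B : Set S} (hB : MeasurableSet B) :
    2 * |(μ B).toReal - (ν B).toReal| ≤ tvDist μ ν :=
  mul_le_mul_of_nonneg_left (le_ciSup (bddAbove_tvDist_range μ ν) ⟨B, hB⟩) zero_le_two

lemma tvDist_le {S : Type*} [MeasurableSpace S] {μ ν : Measure S} {c : ℝ}
    (h : ∀ B, MeasurableSet B → 2 * |(μ B).toReal - (ν B).toReal| ≤ c) : tvDist μ ν ≤ c := by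
  have : Nonempty {B : Set S // MeasurableSet B} := ⟨⟨∅, MeasurableSet.empty⟩⟩
  rw [tvDist, Real.mul_iSup_of_nonneg zero_le_two]
  exact ciSup_le fun B => h B.1 B.2

lemma tvDist_comm {S : Type*} [MeasurableSpace S] (μ ν : Measure S) :
    tvDist μ ν = tvDist ν μ := by
  simp only [tvDist, abs_sub_comm]

/-- The integrals of a function with values in `[m, m + a]` against two probability measures
differ by at most `a / 2` times the total variation distance. -/
lemma two_mul_integral_sub_le_mul_tvDist {S : Type*} [MeasurableSpace S] (μ ν : Measure S)
    [IsProbabilityMeasure μ] [IsProbabilityMeasure ν] {f : S → ℝ} (hf : Measurable f) {m a : ℝ}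
    (ha : 0 ≤ a) (hm : ∀ s, m ≤ f s) (hM : ∀ s, f s ≤ m + a) :
    2 * (∫ s, f s ∂μ - ∫ s, f s ∂ν) ≤ a * tvDist μ ν := by
  have hint (ρ : Measure S) [IsProbabilityMeasure ρ] : Integrable f ρ :=
    Integrable.of_mem_Icc m (m + a) hf.aemeasurable (ae_of_all _ fun s => ⟨hm s, hM s⟩)
  obtain ⟨A, hA⟩ := exists_isHahnDecomposition μ ν
  have hlow : ∫ s in A, (f s - m) ∂μ ≤ ∫ s in A, (f s - m) ∂ν :=
    integral_mono_measure hA.le_on (ae_of_all _ fun s => sub_nonneg.2 (hm s))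
      ((hint ν).sub (integrable_const m)).integrableOn
  have hhigh : ∫ s in Aᶜ, (m + a - f s) ∂ν ≤ ∫ s in Aᶜ, (m + a - f s) ∂μ :=
    integral_mono_measure hA.ge_on_compl (ae_of_all _ fun s => sub_nonneg.2 (hM s))
      ((integrable_const (m + a)).sub (hint μ)).integrableOn
  rw [integral_sub (hint _).integrableOn (integrable_const _),
    integral_sub (hint _).integrableOn (integrable_const _)] at hlow
  rw [integral_sub (integrable_const _) (hint _).integrableOn,
    integral_sub (integrable_const _) (hint _).integrableOn] at hhigh
  simp only [setIntegral_const, smul_eq_mul, probReal_compl_eq_one_sub hA.measurableSet]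
    at hlow hhigh
  rw [← integral_add_compl hA.measurableSet (hint μ),
    ← integral_add_compl hA.measurableSet (hint ν)]
  have htv : 2 * (ν.real A - μ.real A) ≤ tvDist μ ν := by
    have h := two_mul_abs_sub_le_tvDist μ ν hA.measurableSet
    rw [abs_sub_comm] at h
    exact (mul_le_mul_of_nonneg_left (le_abs_self _) zero_le_two).trans h
  nlinarith [mul_le_mul_of_nonneg_left htv ha]

lemma toReal_bind_apply {S : Type*} [MeasurableSpace S] {κ : S → Measure S} (hκm : Measurable κ)
    [∀ s, IsProbabilityMeasure (κ s)] (μ : Measure S) {B : Set S} (hB : MeasurableSet B) :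
    (μ.bind κ B).toReal = ∫ s, (κ s B).toReal ∂μ := by
  rw [Measure.bind_apply hB hκm.aemeasurable, integral_toReal]
  · exact ((Measure.measurable_coe hB).comp hκm).aemeasurable
  · exact ae_of_all _ fun s => measure_lt_top _ _

lemma tvDist_bind_le {S : Type*} [MeasurableSpace S] {κ : S → Measure S} (hκm : Measurable κ)
    [∀ s, IsProbabilityMeasure (κ s)] {α : ℝ} (hα : 0 ≤ α)
    (hκα : ∀ s s', tvDist (κ s) (κ s') ≤ 2 * α) (μ ν : Measure S)
    [IsProbabilityMeasure μ] [IsProbabilityMeasure ν] :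
    tvDist (μ.bind κ) (ν.bind κ) ≤ α * tvDist μ ν := by
  refine tvDist_le fun B hB => ?_
  rw [toReal_bind_apply hκm μ hB, toReal_bind_apply hκm ν hB]
  have : Nonempty S := nonempty_of_isProbabilityMeasure μ
  have hf : Measurable fun s => (κ s B).toReal :=
    ((Measure.measurable_coe hB).comp hκm).ennreal_toReal
  have hbdd : BddBelow (Set.range fun s => (κ s B).toReal) :=
    ⟨0, Set.forall_mem_range.2 fun _ => ENNReal.toReal_nonneg⟩
  have hm (s : S) : ⨅ s, (κ s B).toReal ≤ (κ s B).toReal := ciInf_le hbdd s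
  have hM (s : S) : (κ s B).toReal ≤ (⨅ s, (κ s B).toReal) + α := by
    rw [← sub_le_iff_le_add]
    refine le_ciInf fun s' => ?_
    have h := (two_mul_abs_sub_le_tvDist (κ s) (κ s') hB).trans (hκα s s')
    linarith [le_abs_self ((κ s B).toReal - (κ s' B).toReal)]
  rw [← le_div_iff₀' zero_lt_two, abs_le', le_div_iff₀' zero_lt_two, le_div_iff₀' zero_lt_two]
  refine ⟨two_mul_integral_sub_le_mul_tvDist μ ν hf hα hm hM, ?_⟩
  rw [neg_sub, tvDist_comm μ ν]
  exact two_mul_integral_sub_le_mul_tvDist ν μ hf hα hm hM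

lemma isProbabilityMeasure_stepIter {S : Type*} [MeasurableSpace S] {κ : S → Measure S}
    (hκm : Measurable κ) [∀ s, IsProbabilityMeasure (κ s)] (μ : Measure S)
    [IsProbabilityMeasure μ] (t : ℕ) : IsProbabilityMeasure (stepIter κ t μ) := by
  induction t with
  | zero => assumption
  | succ t ih =>
    rw [stepIter] at ih ⊢
    rw [Function.iterate_succ_apply']
    exact isProbabilityMeasure_bind hκm.aemeasurable (ae_of_all _ inferInstance)

/-- Under the Doeblin condition with coefficient `α ∈ (0,1)`, the
`t`-step distributions of any two probability measures contract in total variation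
at geometric rate `α`. -/
theorem doeblin_contraction {S : Type*} [MeasurableSpace S]
    (κ : S → Measure S) (hκm : Measurable κ)
    (hκp : ∀ s, IsProbabilityMeasure (κ s))
    (α : ℝ) (hα : α ∈ Set.Ioo (0 : ℝ) 1)
    (hDoeblin : ∀ s s' : S, tvDist (κ s) (κ s') ≤ 2 * α)
    (μ₁ μ₂ : Measure S) [IsProbabilityMeasure μ₁] [IsProbabilityMeasure μ₂]
    (t : ℕ) :
    tvDist (stepIter κ t μ₁) (stepIter κ t μ₂) ≤ α ^ t * tvDist μ₁ μ₂ := by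
  induction t with
  | zero => simp [stepIter]
  | succ t ih =>
    have := isProbabilityMeasure_stepIter hκm μ₁ t
    have := isProbabilityMeasure_stepIter hκm μ₂ t
    have hstep := tvDist_bind_le hκm hα.1.le hDoeblin (stepIter κ t μ₁) (stepIter κ t μ₂)
    calc tvDist (stepIter κ (t + 1) μ₁) (stepIter κ (t + 1) μ₂)
        = tvDist ((stepIter κ t μ₁).bind κ) ((stepIter κ t μ₂).bind κ) := by
          simp only [stepIter, Function.iterate_succ_apply']
      _ ≤ α * (α ^ t * tvDist μ₁ μ₂) := hstep.trans (mul_le_mul_of_nonneg_left ih hα.1.le)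
      _ = α ^ (t + 1) * tvDist μ₁ μ₂ := by ring
end

section
/- Let S and A be measurable spaces, let p be a Markov kernel from S × A to S satisfying ‖p(s,a,·) − p(s′,a′,·)‖_TV ≤ 2α for all (s,a), (s′,a′) ∈ S × A with α ∈ (0,1), let φ : S → A be measurable with induced kernel κ_φ(s) := p(s, φ(s)), let r : S × A → ℝ be measurable with values in [0,1], and fix s⋆ ∈ S. Let μ∞_{φ,p} be the invariant probability measure of κ_φ, let J(φ) := ∫ r(x, φ(x)) dμ∞_{φ,p}(x), and let h^φ(s) := Σ_{t=0}^∞ ( ∫ r(x, φ(x)) dμ_t^{φ,s}(x) − ∫ r(x, φ(x)) dμ_t^{φ,s⋆}(x) ). Then (J(φ), h^φ) satisfies the Poisson (average reward evaluation) equation: for every s ∈ S, J(φ) + h^φ(s) = r(s, φ(s)) + ∫ h^φ(s′) dκ_φ(s)(s′), and h^φ(s⋆) = 0. -/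
open MeasureTheory

open ProbabilityTheory

/-- If the oscillation of a measurable function `g` is at most `c`, its integrals under two
probability measures at total variation distance at most `2 * α` differ by at most `α * c`. -/
lemma abs_integral_sub_le_of_tvDist_le {S : Type*} [MeasurableSpace S] [Nonempty S]
    {μ ν : Measure S} [IsProbabilityMeasure μ] [IsProbabilityMeasure ν] {α c : ℝ}
    (h : tvDist μ ν ≤ 2 * α) {g : S → ℝ} (hg : Measurable g) (hosc : ∀ x y, |g x - g y| ≤ c) :
    |(∫ x, g x ∂μ) - ∫ x, g x ∂ν| ≤ α * c := by
  obtain ⟨x₀⟩ := ‹Nonempty S›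
  have hc : 0 ≤ c := (abs_nonneg _).trans (hosc x₀ x₀)
  have hbdd : BddBelow (Set.range g) :=
    ⟨g x₀ - c, by rintro _ ⟨y, rfl⟩; linarith [(abs_le.1 (hosc x₀ y)).2]⟩
  set a := ⨅ x, g x
  have h0 : ∀ x, 0 ≤ g x - a := fun x => sub_nonneg.2 (ciInf_le hbdd x)
  have h1 : ∀ x, g x - a ≤ c := fun x => by
    have : g x - c ≤ a :=
      have : Nonempty S := ⟨x₀⟩
      le_ciInf fun y => by linarith [(abs_le.1 (hosc x y)).2]
    linarith
  have hset : ∀ B, MeasurableSet B → |μ.real B - ν.real B| ≤ α := fun B hB => by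
    have hb : BddAbove (Set.range fun B : {B : Set S // MeasurableSet B} =>
        |(μ B.1).toReal - (ν B.1).toReal|) := by
      refine ⟨1, ?_⟩
      rintro _ ⟨B, rfl⟩
      change |μ.real B.1 - ν.real B.1| ≤ 1
      rw [abs_le]
      constructor <;>
        linarith [measureReal_nonneg (μ := μ) (s := B.1), measureReal_nonneg (μ := ν) (s := B.1),
          measureReal_le_one (μ := μ) (s := B.1), measureReal_le_one (μ := ν) (s := B.1)]
    have hle := le_ciSup hb ⟨B, hB⟩
    unfold tvDist at h
    exact hle.trans (by linarith)
  have hInt : ∀ (m : Measure S) [IsProbabilityMeasure m], Integrable (fun x => g x - a) m :=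
    fun m _ => Integrable.of_bound (hg.sub_const a).aestronglyMeasurable c
      (Filter.Eventually.of_forall fun x => by
        rw [Real.norm_eq_abs, abs_of_nonneg (h0 x)]; exact h1 x)
  have hlayer : ∀ (m : Measure S) [IsProbabilityMeasure m],
      (∫ x, g x ∂m) = a + ∫ t in Set.Ioc 0 c, m.real {x | t ≤ g x - a} := fun m _ => by
    rw [← (hInt m).integral_eq_integral_Ioc_meas_le (Filter.Eventually.of_forall h0)
      (Filter.Eventually.of_forall h1)]
    have hg' : Integrable g m := by
      refine ((hInt m).add (integrable_const a)).congr (Filter.Eventually.of_forall fun x => ?_)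
      simp
    rw [integral_sub hg' (integrable_const a)]
    simp
  have hInt' : ∀ (m : Measure S) [IsProbabilityMeasure m],
      IntegrableOn (fun t => m.real {x | t ≤ g x - a}) (Set.Ioc 0 c) := fun m _ => by
    refine Measure.integrableOn_of_bounded (M := 1) (by simp) ?_ ?_
    · have hanti : Antitone fun t => m.real {x | t ≤ g x - a} :=
        fun s t hst => measureReal_mono fun x hx => le_trans hst hx
      exact hanti.measurable.aestronglyMeasurable
    · refine Filter.Eventually.of_forall fun t => ?_
      rw [Real.norm_eq_abs, abs_of_nonneg measureReal_nonneg]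
      exact measureReal_le_one
  rw [hlayer μ, hlayer ν, add_sub_add_left_eq_sub, ← integral_sub (hInt' μ) (hInt' ν)]
  have hfin : volume (Set.Ioc 0 c) < ⊤ := by simp
  have := norm_setIntegral_le_of_norm_le_const (μ := volume) hfin
    (f := fun t => μ.real {x | t ≤ g x - a} - ν.real {x | t ≤ g x - a}) (C := α)
    fun t _ => hset _ (measurableSet_le measurable_const (hg.sub_const a))
  simpa [measureReal_def, ENNReal.toReal_ofReal hc] using this

/-- The transition operator of a kernel, acting on functions. -/
noncomputable def transitionOp {S : Type*} [MeasurableSpace S] (κ : Kernel S S)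
    (g : S → ℝ) (s : S) : ℝ :=
  ∫ y, g y ∂κ s

section TransitionOp

variable {S : Type*} [MeasurableSpace S] {κ : Kernel S S}

lemma integrable_of_abs_le {μ : Measure S} [IsProbabilityMeasure μ] {g : S → ℝ}
    (hg : Measurable g) {C : ℝ} (hC : ∀ x, |g x| ≤ C) : Integrable g μ :=
  Integrable.of_bound hg.aestronglyMeasurable C (Filter.Eventually.of_forall hC)

lemma abs_integral_le {μ : Measure S} [IsProbabilityMeasure μ] {g : S → ℝ} {C : ℝ}
    (hC : ∀ x, |g x| ≤ C) : |∫ x, g x ∂μ| ≤ C := by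
  simpa using norm_integral_le_of_norm_le_const (μ := μ) (f := g) (C := C)
    (Filter.Eventually.of_forall hC)

lemma measurable_transitionOp {g : S → ℝ} (hg : Measurable g) :
    Measurable (transitionOp κ g) :=
  (hg.stronglyMeasurable.integral_kernel (κ := κ)).measurable

lemma measurable_transitionOp_iterate {g : S → ℝ} (hg : Measurable g) (t : ℕ) :
    Measurable ((transitionOp κ)^[t] g) := by
  induction t with
  | zero => exact hg
  | succ t ih =>
    rw [Function.iterate_succ_apply']
    exact measurable_transitionOp ih

variable [IsMarkovKernel κ]

lemma abs_transitionOp_iterate_le {g : S → ℝ} {C : ℝ} (hC : ∀ x, |g x| ≤ C) (t : ℕ) (s : S) :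
    |(transitionOp κ)^[t] g s| ≤ C := by
  induction t generalizing s with
  | zero => exact hC s
  | succ t ih =>
    rw [Function.iterate_succ_apply']
    exact abs_integral_le ih

lemma integral_bind_eq_integral_transitionOp {m : Measure S} [IsProbabilityMeasure m]
    {g : S → ℝ} (hg : Measurable g) {C : ℝ} (hC : ∀ x, |g x| ≤ C) :
    ∫ x, g x ∂(m.bind κ) = ∫ x, transitionOp κ g x ∂m := by
  have h := Kernel.integral_comp (η := κ) (κ := Kernel.const Unit m) (a := ()) (f := g)
    (integrable_of_abs_le hg hC)
  rwa [Kernel.comp_apply, Kernel.const_apply] at h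

lemma integral_stepIter {m : Measure S} [IsProbabilityMeasure m] {g : S → ℝ}
    (hg : Measurable g) {C : ℝ} (hC : ∀ x, |g x| ≤ C) (t : ℕ) :
    ∫ x, g x ∂(stepIter κ t m) = ∫ x, (transitionOp κ)^[t] g x ∂m := by
  induction t generalizing m with
  | zero => rfl
  | succ t ih =>
    rw [Function.iterate_succ_apply']
    exact (ih (m := m.bind κ)).trans (integral_bind_eq_integral_transitionOp
      (measurable_transitionOp_iterate hg t) (abs_transitionOp_iterate_le hC t))

lemma integral_transitionOp_iterate_of_invariant {m : Measure S} [IsProbabilityMeasure m]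
    (hm : m.bind κ = m) {g : S → ℝ} (hg : Measurable g) {C : ℝ} (hC : ∀ x, |g x| ≤ C) (t : ℕ) :
    ∫ x, (transitionOp κ)^[t] g x ∂m = ∫ x, g x ∂m := by
  rw [← integral_stepIter hg hC t]
  exact congrArg (fun μ => ∫ x, g x ∂μ) (Function.iterate_fixed hm t)

/-- Geometric decay of the oscillation under a Doeblin condition. -/
lemma transitionOp_iterate_osc_le {α c : ℝ}
    (hD : ∀ s s', tvDist (κ s) (κ s') ≤ 2 * α) {g : S → ℝ} (hg : Measurable g)
    (hosc : ∀ x y, |g x - g y| ≤ c) (t : ℕ) (s s' : S) :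
    |(transitionOp κ)^[t] g s - (transitionOp κ)^[t] g s'| ≤ α ^ t * c := by
  induction t generalizing s s' with
  | zero => simpa using hosc s s'
  | succ t ih =>
    have : Nonempty S := ⟨s⟩
    rw [Function.iterate_succ_apply', pow_succ', mul_assoc]
    exact abs_integral_sub_le_of_tvDist_le (hD s s') (measurable_transitionOp_iterate hg t) ih

/-- The Poisson equation for the bias function of a Doeblin kernel. -/
lemma poisson_equation_transitionOp {α : ℝ} (hα : α ∈ Set.Ioo (0 : ℝ) 1)
    (hD : ∀ s s', tvDist (κ s) (κ s') ≤ 2 * α) {g : S → ℝ} (hg : Measurable g) {C c : ℝ}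
    (hC : ∀ x, |g x| ≤ C) (hosc : ∀ x y, |g x - g y| ≤ c)
    {m : Measure S} [IsProbabilityMeasure m] (hm : m.bind κ = m) (s₀ s : S) :
    (∫ x, g x ∂m) + ∑' t : ℕ, ((transitionOp κ)^[t] g s - (transitionOp κ)^[t] g s₀) =
      g s + ∫ s', (∑' t : ℕ, ((transitionOp κ)^[t] g s' - (transitionOp κ)^[t] g s₀)) ∂κ s := by
  set u : ℕ → S → ℝ := fun t => (transitionOp κ)^[t] g with hu
  have hdec : ∀ t x y, |u t x - u t y| ≤ α ^ t * c := transitionOp_iterate_osc_le hD hg hosc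
  have hgeo : Summable fun t : ℕ => α ^ t * c :=
    (summable_geometric_of_lt_one hα.1.le hα.2).mul_right c
  have hmeas : ∀ t, Measurable (u t) := measurable_transitionOp_iterate hg
  have hInt : ∀ t (μ : Measure S) [IsProbabilityMeasure μ], Integrable (u t) μ := fun t μ _ =>
    integrable_of_abs_le (hmeas t) (abs_transitionOp_iterate_le hC t)
  have hintd : ∀ t (μ : Measure S) [IsProbabilityMeasure μ] (y : ℝ),
      ∫ x, (u t x - y) ∂μ = (∫ x, u t x ∂μ) - y := fun t μ _ y => by
    rw [integral_sub (hInt t μ) (integrable_const y)]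
    simp
  have hsucc : ∀ t, ∫ x, u t x ∂κ s = u (t + 1) s := fun t => by
    simp only [hu, Function.iterate_succ_apply']
    rfl
  have hsum₁ : HasSum (fun t => u t s - u t s₀) (∑' t, (u t s - u t s₀)) :=
    (hgeo.of_norm_bounded fun t => hdec t s s₀).hasSum
  have hsum₂ : HasSum (fun t => u (t + 1) s - u t s₀)
      (∫ s', (∑' t, (u t s' - u t s₀)) ∂κ s) := by
    have h := hasSum_integral_of_summable_integral_norm (μ := κ s)
      (F := fun t x => u t x - u t s₀) (fun t => (hInt t _).sub (integrable_const _))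
      (hgeo.of_nonneg_of_le (fun t => integral_nonneg fun x => norm_nonneg _) fun t =>
        (le_abs_self _).trans (abs_integral_le fun x => by simpa using hdec t x s₀))
    simpa only [hintd, hsucc] using h
  have hlim : Filter.Tendsto (fun n => u n s) Filter.atTop (nhds (∫ x, g x ∂m)) := by
    refine tendsto_iff_norm_sub_tendsto_zero.2
      (squeeze_zero (fun n => norm_nonneg _) (fun n => ?_) hgeo.tendsto_atTop_zero)
    rw [← integral_transitionOp_iterate_of_invariant hm hg hC n, norm_sub_rev, ← hintd n m]
    exact abs_integral_le fun x => hdec n x s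
  have htel : ∀ n, (∑ t ∈ Finset.range n, (u t s - u t s₀)) -
      ∑ t ∈ Finset.range n, (u (t + 1) s - u t s₀) = g s - u n s := fun n => by
    rw [← Finset.sum_sub_distrib]
    simp only [sub_sub_sub_cancel_right]
    exact Finset.sum_range_sub' (fun t => u t s) n
  have h₁ := hsum₁.tendsto_sum_nat.sub hsum₂.tendsto_sum_nat
  simp only [htel] at h₁
  linarith [tendsto_nhds_unique h₁ (hlim.const_sub (g s))]

end TransitionOp

/-- For a Doeblin kernel, a measurable policy `φ` with induced kernel
`κ_φ(s) = p(s,φ(s))` and invariant probability measure `μ∞`, and a `[0,1]`-valued reward,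
the pair `(J(φ), h^φ)` with `J(φ) = ∫ r(·,φ(·)) dμ∞` and
`h^φ(s) = Σ_t (∫ r(·,φ(·)) dμ_t^{φ,s} − ∫ r(·,φ(·)) dμ_t^{φ,s⋆})` satisfies the Poisson
equation `J(φ) + h^φ(s) = r(s,φ(s)) + ∫ h^φ dκ_φ(s)` for all `s`, and `h^φ(s⋆) = 0`. -/
theorem poisson_equation_solution {S A : Type*}
    [MeasurableSpace S] [MeasurableSpace A]
    (p : S × A → Measure S) (hpm : Measurable p)
    (hpp : ∀ z, IsProbabilityMeasure (p z))
    (α : ℝ) (hα : α ∈ Set.Ioo (0 : ℝ) 1)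
    (hDoeblin : ∀ z z' : S × A, tvDist (p z) (p z') ≤ 2 * α)
    (φ : S → A) (hφ : Measurable φ)
    (r : S × A → ℝ) (hrm : Measurable r) (hrb : ∀ z, r z ∈ Set.Icc (0 : ℝ) 1)
    (sstar : S)
    (μinf : Measure S) [IsProbabilityMeasure μinf]
    (hinv : μinf.bind (fun s => p (s, φ s)) = μinf) :
    (∀ s : S,
        (∫ x, r (x, φ x) ∂μinf) +
          (∑' t : ℕ,
            ((∫ x, r (x, φ x) ∂(stepIter (fun s' => p (s', φ s')) t (Measure.dirac s))) -
              ∫ x, r (x, φ x) ∂(stepIter (fun s' => p (s', φ s')) t (Measure.dirac sstar)))) =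
        r (s, φ s) +
          ∫ s', (∑' t : ℕ,
            ((∫ x, r (x, φ x) ∂(stepIter (fun s'' => p (s'', φ s'')) t (Measure.dirac s'))) -
              ∫ x, r (x, φ x) ∂(stepIter (fun s'' => p (s'', φ s'')) t (Measure.dirac sstar))))
            ∂(p (s, φ s))) ∧
    (∑' t : ℕ,
        ((∫ x, r (x, φ x) ∂(stepIter (fun s' => p (s', φ s')) t (Measure.dirac sstar))) -
          ∫ x, r (x, φ x) ∂(stepIter (fun s' => p (s', φ s')) t (Measure.dirac sstar)))) = 0 := by
  let κ : Kernel S S := ⟨fun s => p (s, φ s), hpm.comp (measurable_id.prodMk hφ)⟩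
  have : IsMarkovKernel κ := ⟨fun s => hpp (s, φ s)⟩
  have hf : Measurable fun x => r (x, φ x) := hrm.comp (measurable_id.prodMk hφ)
  have hC : ∀ x, |r (x, φ x)| ≤ 1 := fun x => by
    rw [abs_of_nonneg (hrb _).1]
    exact (hrb _).2
  have hosc : ∀ x y, |r (x, φ x) - r (y, φ y)| ≤ 1 := fun x y =>
    abs_sub_le_of_nonneg_of_le (hrb _).1 (hrb _).2 (hrb _).1 (hrb _).2
  have hstep : ∀ (t : ℕ) (s : S),
      ∫ x, r (x, φ x) ∂(stepIter (fun s' => p (s', φ s')) t (Measure.dirac s)) =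
        (transitionOp κ)^[t] (fun x => r (x, φ x)) s := fun t s =>
    (integral_stepIter (κ := κ) hf hC t).trans
      (integral_dirac' _ _ (measurable_transitionOp_iterate hf t).stronglyMeasurable)
  refine ⟨fun s => ?_, by simp⟩
  simp only [hstep]
  exact poisson_equation_transitionOp (κ := κ) hα (fun _ _ => hDoeblin _ _) hf hC hosc hinv
    sstar s
end

section
/- Let S be a measurable space, let κ be a Markov kernel on S satisfying ‖κ(s) − κ(s′)‖_TV ≤ 2α for all s, s′ ∈ S with α ∈ (0,1), let r̄ : S → ℝ be a bounded measurable function, and fix s⋆ ∈ S. Suppose (J₁, h₁) and (J₂, h₂), with J₁, J₂ ∈ ℝ and h₁, h₂ : S → ℝ bounded measurable, both satisfy the Poisson equation J + h(s) = r̄(s) + ∫ h(s′) dκ(s)(s′) for all s ∈ S, together with the normalization h₁(s⋆) = h₂(s⋆) = 0. Then J₁ = J₂ and h₁ = h₂. -/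
open MeasureTheory

/-- Each event's probability difference is at most half the total variation distance. -/
lemma abs_measureReal_sub_le_of_tvDist_le {S : Type*} [MeasurableSpace S] {μ ν : Measure S}
    [IsProbabilityMeasure μ] [IsProbabilityMeasure ν] {α : ℝ} (h : tvDist μ ν ≤ 2 * α)
    {B : Set S} (hB : MeasurableSet B) : |μ.real B - ν.real B| ≤ α := by
  have hbdd : BddAbove (Set.range fun B : {B : Set S // MeasurableSet B} =>
      |(μ B.1).toReal - (ν B.1).toReal|) := by
    refine ⟨1, ?_⟩
    rintro _ ⟨A, rfl⟩
    change |μ.real A.1 - ν.real A.1| ≤ 1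
    rw [abs_le]
    constructor <;>
      linarith [measureReal_le_one (μ := μ) (s := A.1), measureReal_le_one (μ := ν) (s := A.1),
        measureReal_nonneg (μ := μ) (s := A.1), measureReal_nonneg (μ := ν) (s := A.1)]
  have hle := le_ciSup hbdd ⟨B, hB⟩
  unfold tvDist at h
  change |μ.real B - ν.real B| ≤ _ at hle
  linarith

lemma integral_sub_integral_le_of_tvDist_le {S : Type*} [MeasurableSpace S] {μ ν : Measure S}
    [IsProbabilityMeasure μ] [IsProbabilityMeasure ν] {α : ℝ} (h : tvDist μ ν ≤ 2 * α)
    {f : S → ℝ} (hf : Measurable f) {a b : ℝ} (ha : ∀ s, a ≤ f s) (hb : ∀ s, f s ≤ b) :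
    ∫ s, f s ∂μ - ∫ s, f s ∂ν ≤ α * (b - a) := by
  have hint (ρ : Measure S) [IsProbabilityMeasure ρ] : Integrable f ρ :=
    Integrable.of_mem_Icc a b hf.aemeasurable (.of_forall fun s => ⟨ha s, hb s⟩)
  have hlayer (ρ : Measure S) [IsProbabilityMeasure ρ] :
      ∫ s, f s ∂ρ - a = ∫ t in Set.Ioc 0 (b - a), ρ.real {s | t ≤ f s - a} := by
    rw [← Integrable.integral_eq_integral_Ioc_meas_le (f := fun s => f s - a)
      ((hint ρ).sub (integrable_const a))
      (.of_forall fun s => sub_nonneg.2 (ha s))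
      (.of_forall fun s => sub_le_sub_right (hb s) a)]
    simp [integral_sub (hint ρ) (integrable_const a)]
  have htail (ρ : Measure S) [IsProbabilityMeasure ρ] :
      IntegrableOn (fun t : ℝ => ρ.real {s | t ≤ f s - a}) (Set.Ioc 0 (b - a)) := by
    have hanti : Antitone (fun t : ℝ => ρ.real {s | t ≤ f s - a}) := fun t u htu =>
      measureReal_mono fun s (hs : u ≤ f s - a) => htu.trans hs
    exact Integrable.of_mem_Icc 0 1 hanti.measurable.aemeasurable
      (.of_forall fun t => ⟨measureReal_nonneg, measureReal_le_one⟩)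
  obtain ⟨s₀⟩ : Nonempty S := nonempty_of_isProbabilityMeasure μ
  have hab : 0 ≤ b - a := sub_nonneg.2 ((ha s₀).trans (hb s₀))
  calc ∫ s, f s ∂μ - ∫ s, f s ∂ν
      = ∫ t in Set.Ioc 0 (b - a), (μ.real {s | t ≤ f s - a} - ν.real {s | t ≤ f s - a}) := by
        rw [integral_sub (htail μ) (htail ν), ← hlayer μ, ← hlayer ν]
        ring
    _ ≤ ∫ _ in Set.Ioc 0 (b - a), α :=
        integral_mono ((htail μ).sub (htail ν)) (integrable_const α) fun t =>
          (le_abs_self _).trans <| abs_measureReal_sub_le_of_tvDist_le h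
            (measurableSet_le measurable_const (hf.sub_const a))
    _ = α * (b - a) := by
        simp [hab, mul_comm]

/-- For a Doeblin Markov kernel `κ` and a bounded measurable reward `r̄`,
two bounded measurable solutions of the Poisson equation with the normalization
`h(s⋆) = 0` must coincide. -/
theorem poisson_equation_unique {S : Type*} [MeasurableSpace S]
    (κ : S → Measure S) (hκm : Measurable κ)
    (hκp : ∀ s, IsProbabilityMeasure (κ s))
    (α : ℝ) (hα : α ∈ Set.Ioo (0 : ℝ) 1)
    (hDoeblin : ∀ s s' : S, tvDist (κ s) (κ s') ≤ 2 * α)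
    (rbar : S → ℝ) (hrm : Measurable rbar) (Cr : ℝ) (hrb : ∀ s, |rbar s| ≤ Cr)
    (sstar : S)
    (J₁ J₂ : ℝ) (h₁ h₂ : S → ℝ)
    (hh₁m : Measurable h₁) (hh₂m : Measurable h₂)
    (C₁ : ℝ) (hh₁b : ∀ s, |h₁ s| ≤ C₁)
    (C₂ : ℝ) (hh₂b : ∀ s, |h₂ s| ≤ C₂)
    (hPoisson₁ : ∀ s, J₁ + h₁ s = rbar s + ∫ s', h₁ s' ∂(κ s))
    (hPoisson₂ : ∀ s, J₂ + h₂ s = rbar s + ∫ s', h₂ s' ∂(κ s))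
    (hnorm₁ : h₁ sstar = 0) (hnorm₂ : h₂ sstar = 0) :
    J₁ = J₂ ∧ h₁ = h₂ := by
  have hint₁ (s : S) : Integrable h₁ (κ s) :=
    Integrable.of_mem_Icc (-C₁) C₁ hh₁m.aemeasurable (.of_forall fun x => abs_le.1 (hh₁b x))
  have hint₂ (s : S) : Integrable h₂ (κ s) :=
    Integrable.of_mem_Icc (-C₂) C₂ hh₂m.aemeasurable (.of_forall fun x => abs_le.1 (hh₂b x))
  let g : S → ℝ := fun s => h₁ s - h₂ s
  have hg (s : S) : (J₁ - J₂) + g s = ∫ x, g x ∂(κ s) := by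
    rw [integral_sub (hint₁ s) (hint₂ s)]
    linarith [hPoisson₁ s, hPoisson₂ s]
  have hbound (s : S) : |g s| ≤ C₁ + C₂ :=
    (abs_sub _ _).trans (add_le_add (hh₁b s) (hh₂b s))
  have hbelow : BddBelow (Set.range g) :=
    ⟨-(C₁ + C₂), Set.forall_mem_range.2 fun s => (abs_le.1 (hbound s)).1⟩
  have habove : BddAbove (Set.range g) :=
    ⟨C₁ + C₂, Set.forall_mem_range.2 fun s => (abs_le.1 (hbound s)).2⟩
  have : Nonempty S := ⟨sstar⟩
  have hcontract (s s' : S) : g s - g s' ≤ α * ((⨆ x, g x) - ⨅ x, g x) := by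
    have := integral_sub_integral_le_of_tvDist_le (f := g) (hDoeblin s s') (hh₁m.sub hh₂m)
      (ciInf_le hbelow) (le_ciSup habove)
    linarith [hg s, hg s']
  have hspan : (⨆ x, g x) - (⨅ x, g x) ≤ α * ((⨆ x, g x) - ⨅ x, g x) := by
    rw [sub_le_iff_le_add]
    refine ciSup_le fun s => ?_
    rw [← sub_le_iff_le_add']
    refine le_ciInf fun s' => ?_
    linarith [hcontract s s']
  have hle : (⨆ x, g x) ≤ ⨅ x, g x := by
    nlinarith [hα.2]
  have hstar : g sstar = 0 := by simp [g, hnorm₁, hnorm₂]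
  have hzero (s : S) : g s = 0 := by
    linarith [ciInf_le hbelow s, le_ciSup habove s, ciInf_le hbelow sstar, le_ciSup habove sstar]
  refine ⟨?_, funext fun s => sub_eq_zero.1 (hzero s)⟩
  have := hg sstar
  simp only [hzero, integral_zero, add_zero] at this
  exact sub_eq_zero.1 this
end

section
/- Let S and A be measurable spaces, let p be a Markov kernel from S × A to S satisfying ‖p(s,a,·) − p(s′,a′,·)‖_TV ≤ 2α for all (s,a), (s′,a′) ∈ S × A with α ∈ (0,1), let φ : S → A be measurable with induced kernel κ_φ(s) := p(s, φ(s)) and invariant probability measure μ∞_{φ,p}, and let r : S × A → ℝ be bounded measurable. Let J⋆ ∈ ℝ and let h : S → ℝ be bounded measurable, and define the suboptimality gap function gap(s) := J⋆ + h(s) − r(s, φ(s)) − ∫ h(s′) dκ_φ(s)(s′). Suppose J_φ ∈ ℝ and a bounded measurable h^φ : S → ℝ satisfy the Poisson equation J_φ + h^φ(s) = r(s, φ(s)) + ∫ h^φ(s′) dκ_φ(s)(s′) for all s ∈ S. Then J⋆ − J_φ = ∫ gap(s) dμ∞_{φ,p}(s). -/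
open MeasureTheory

open ProbabilityTheory in
/-- The mean of a bounded measurable function does not change under one step of a Markov kernel
that leaves the measure invariant. -/
theorem integrable_and_integral_integral_eq_of_bind_eq {S : Type*} [MeasurableSpace S]
    (κ : Kernel S S) (μ : Measure S) [IsFiniteMeasure μ]
    (hinv : μ.bind κ = μ) {f : S → ℝ} (hf : Measurable f) {C : ℝ} (hC : ∀ s, |f s| ≤ C) :
    Integrable f μ ∧ Integrable (fun s => ∫ s', f s' ∂(κ s)) μ ∧
      ∫ s, ∫ s', f s' ∂(κ s) ∂μ = ∫ s, f s ∂μ := by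
  have hf_int : Integrable f μ :=
    Integrable.of_bound hf.aestronglyMeasurable C (Filter.Eventually.of_forall hC)
  have hcomp : (κ ∘ₖ Kernel.const Unit μ) () = μ := by
    rw [← Measure.comp_eq_comp_const_apply, hinv]
  have hf_comp : Integrable f ((κ ∘ₖ Kernel.const Unit μ) ()) := by rwa [hcomp]
  have hf_avg := hf_comp.integral_comp
  have heq := Kernel.integral_comp hf_comp
  rw [Kernel.const_apply] at hf_avg heq
  rw [hcomp] at heq
  exact ⟨hf_int, hf_avg, heq.symm⟩

/-- For a Doeblin kernel `p`, a measurable policy `φ` with induced kernel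
`κ_φ(s) = p(s,φ(s))` and invariant probability measure `μ∞`, bounded measurable reward
`r`, any `J⋆ ∈ ℝ` and bounded measurable `h : S → ℝ`, and any bounded measurable Poisson
solution `(J_φ, h^φ)` for the policy `φ`, the suboptimality identity
`J⋆ − J_φ = ∫ gap(s) dμ∞(s)` holds, where
`gap(s) = J⋆ + h(s) − r(s,φ(s)) − ∫ h dκ_φ(s)`. -/
theorem suboptimality_gap_identity {S A : Type*}
    [MeasurableSpace S] [MeasurableSpace A]
    (p : S × A → Measure S) (hpm : Measurable p)
    (hpp : ∀ z, IsProbabilityMeasure (p z))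
    (α : ℝ) (hα : α ∈ Set.Ioo (0 : ℝ) 1)
    (hDoeblin : ∀ z z' : S × A, tvDist (p z) (p z') ≤ 2 * α)
    (φ : S → A) (hφ : Measurable φ)
    (μinf : Measure S) [IsProbabilityMeasure μinf]
    (hinv : μinf.bind (fun s => p (s, φ s)) = μinf)
    (r : S × A → ℝ) (hrm : Measurable r) (Cr : ℝ) (hrb : ∀ z, |r z| ≤ Cr)
    (Jstar : ℝ) (h : S → ℝ) (hhm : Measurable h) (Ch : ℝ) (hhb : ∀ s, |h s| ≤ Ch)
    (Jφ : ℝ) (hφfun : S → ℝ) (hφfunm : Measurable hφfun)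
    (Cφ : ℝ) (hφfunb : ∀ s, |hφfun s| ≤ Cφ)
    (hPoisson : ∀ s, Jφ + hφfun s = r (s, φ s) + ∫ s', hφfun s' ∂(p (s, φ s))) :
    Jstar - Jφ =
      ∫ s, (Jstar + h s - r (s, φ s) - ∫ s', h s' ∂(p (s, φ s))) ∂μinf := by
  let κ : ProbabilityTheory.Kernel S S := ⟨fun s => p (s, φ s), by fun_prop⟩
  obtain ⟨h_int, h_int', h_eq⟩ :=
    integrable_and_integral_integral_eq_of_bind_eq κ μinf hinv hhm hhb
  obtain ⟨g_int, g_int', g_eq⟩ :=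
    integrable_and_integral_integral_eq_of_bind_eq κ μinf hinv hφfunm hφfunb
  change Integrable (fun s => ∫ s', h s' ∂(p (s, φ s))) μinf at h_int'
  change Integrable (fun s => ∫ s', hφfun s' ∂(p (s, φ s))) μinf at g_int'
  change ∫ s, ∫ s', h s' ∂(p (s, φ s)) ∂μinf = _ at h_eq
  change ∫ s, ∫ s', hφfun s' ∂(p (s, φ s)) ∂μinf = _ at g_eq
  have key : ∀ s, Jstar + h s - r (s, φ s) - ∫ s', h s' ∂(p (s, φ s)) =
      (Jstar - Jφ) + ((h s - ∫ s', h s' ∂(p (s, φ s))) -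
        (hφfun s - ∫ s', hφfun s' ∂(p (s, φ s)))) := fun s => by
    linarith [hPoisson s]
  have h_sub : ∫ s, (h s - ∫ s', h s' ∂(p (s, φ s))) ∂μinf = 0 := by
    rw [integral_sub h_int h_int', h_eq, sub_self]
  have g_sub : ∫ s, (hφfun s - ∫ s', hφfun s' ∂(p (s, φ s))) ∂μinf = 0 := by
    rw [integral_sub g_int g_int', g_eq, sub_self]
  have diff_int : Integrable (fun s => (h s - ∫ s', h s' ∂(p (s, φ s))) -
      (hφfun s - ∫ s', hφfun s' ∂(p (s, φ s)))) μinf :=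
    (h_int.sub h_int').sub (g_int.sub g_int')
  simp_rw [key]
  rw [integral_add (integrable_const (Jstar - Jφ)) diff_int,
    integral_sub (f := fun s => h s - ∫ s', h s' ∂(p (s, φ s)))
      (g := fun s => hφfun s - ∫ s', hφfun s' ∂(p (s, φ s)))
      (h_int.sub h_int') (g_int.sub g_int'), h_sub, g_sub]
  simp
end

section
/- Let Z be a measurable space, let μ₁ and μ₂ be probability measures on Z, and let v : Z → ℝ be a bounded measurable function. Then |∫ v dμ₁ − ∫ v dμ₂| ≤ (1/2)·‖μ₁ − μ₂‖_TV · span(v), where span(v) := sup_{z ∈ Z} v(z) − inf_{z ∈ Z} v(z). -/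
open MeasureTheory

/-- The discrepancy of two probability measures on a measurable set is at most half their total
variation distance. -/
lemma abs_measureReal_sub_le_tvDist {Z : Type*} [MeasurableSpace Z] (μ ν : Measure Z)
    [IsProbabilityMeasure μ] [IsProbabilityMeasure ν] {B : Set Z} (hB : MeasurableSet B) :
    |μ.real B - ν.real B| ≤ (1 / 2) * tvDist μ ν := by
  have hbdd : BddAbove (Set.range fun B : {B : Set Z // MeasurableSet B} =>
      |(μ B.1).toReal - (ν B.1).toReal|) := by
    refine ⟨1, ?_⟩
    rintro _ ⟨B, rfl⟩
    have hμ : μ.real B.1 ≤ 1 := measureReal_le_one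
    have hν : ν.real B.1 ≤ 1 := measureReal_le_one
    exact abs_sub_le_of_nonneg_of_le measureReal_nonneg hμ measureReal_nonneg hν
  have h := le_ciSup hbdd ⟨B, hB⟩
  rw [tvDist, ← mul_assoc, one_div_mul_cancel two_ne_zero, one_mul]
  exact h

lemma integrableOn_Ioc_measureReal_le {Z : Type*} [MeasurableSpace Z] (μ : Measure Z)
    [IsFiniteMeasure μ] (f : Z → ℝ) (a b : ℝ) :
    IntegrableOn (fun t => μ.real {z | t ≤ f z}) (Set.Ioc a b) := by
  have hanti : Antitone fun t => μ.real {z | t ≤ f z} := fun s t hst =>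
    measureReal_mono fun z (hz : t ≤ f z) => hst.trans hz
  exact (hanti.antitoneOn _).integrableOn_isCompact isCompact_Icc |>.mono_set Set.Ioc_subset_Icc_self

/-- The layer-cake form of the total variation bound, for functions with values in `[0, M]`. -/
lemma abs_integral_sub_le_tvDist_mul {Z : Type*} [MeasurableSpace Z] (μ ν : Measure Z)
    [IsProbabilityMeasure μ] [IsProbabilityMeasure ν] {f : Z → ℝ} (hf : Measurable f) {M : ℝ}
    (hM : 0 ≤ M) (h0 : ∀ z, 0 ≤ f z) (hfM : ∀ z, f z ≤ M) :
    |(∫ z, f z ∂μ) - ∫ z, f z ∂ν| ≤ (1 / 2) * tvDist μ ν * M := by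
  have hint (ρ : Measure Z) [IsProbabilityMeasure ρ] : Integrable f ρ :=
    .of_bound hf.aestronglyMeasurable M (.of_forall fun z => by
      rw [Real.norm_of_nonneg (h0 z)]; exact hfM z)
  rw [(hint μ).integral_eq_integral_Ioc_meas_le (.of_forall h0) (.of_forall hfM),
    (hint ν).integral_eq_integral_Ioc_meas_le (.of_forall h0) (.of_forall hfM),
    ← integral_sub (integrableOn_Ioc_measureReal_le μ f 0 M)
      (integrableOn_Ioc_measureReal_le ν f 0 M)]
  have h := norm_setIntegral_le_of_norm_le_const (μ := volume) (s := Set.Ioc 0 M)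
    (f := fun t => μ.real {z | t ≤ f z} - ν.real {z | t ≤ f z}) measure_Ioc_lt_top
    fun t _ => abs_measureReal_sub_le_tvDist μ ν (measurableSet_le measurable_const hf)
  rwa [Real.volume_real_Ioc_of_le hM, sub_zero] at h

/-- For probability measures `μ₁, μ₂` and a bounded measurable function
`v`, `|∫ v dμ₁ − ∫ v dμ₂| ≤ (1/2) ‖μ₁ − μ₂‖_TV · span(v)` where
`span(v) = sup v − inf v`. -/
theorem integral_diff_le_tv_span {Z : Type*} [MeasurableSpace Z]
    (μ₁ μ₂ : Measure Z) [IsProbabilityMeasure μ₁] [IsProbabilityMeasure μ₂]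
    (v : Z → ℝ) (hvm : Measurable v) (C : ℝ) (hvb : ∀ z, |v z| ≤ C) :
    |(∫ z, v z ∂μ₁) - ∫ z, v z ∂μ₂| ≤
      (1 / 2) * tvDist μ₁ μ₂ * ((⨆ z, v z) - ⨅ z, v z) := by
  obtain ⟨z₀⟩ : Nonempty Z := nonempty_of_isProbabilityMeasure μ₁
  have hle (z : Z) : v z ≤ ⨆ z, v z :=
    le_ciSup ⟨C, Set.forall_mem_range.2 fun z => (abs_le.1 (hvb z)).2⟩ z
  have hge (z : Z) : ⨅ z, v z ≤ v z :=
    ciInf_le ⟨-C, Set.forall_mem_range.2 fun z => (abs_le.1 (hvb z)).1⟩ z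
  have h := abs_integral_sub_le_tvDist_mul μ₁ μ₂ (hvm.sub_const (⨅ z, v z))
    (sub_nonneg.2 ((hge z₀).trans (hle z₀))) (fun z => sub_nonneg.2 (hge z))
    (fun z => sub_le_sub_right (hle z) _)
  have hint (ρ : Measure Z) [IsProbabilityMeasure ρ] : Integrable v ρ :=
    .of_bound hvm.aestronglyMeasurable C (.of_forall hvb)
  simpa [integral_sub (hint _) (integrable_const _)] using h
end

section
/- Let (S, Σ, λ) be a measure space with λ(S) < ∞, let μ be a probability measure on S with density f with respect to λ, let {ξ₁, …, ξ_n} be a finite measurable partition of S with λ(ξ_i) > 0 for each i, and let C ≥ 0 be such that for each i and all x, y ∈ ξ_i, f(x) ≤ f(y) + C. Define the piecewise-uniform smoothing μ̄ of μ by μ̄(B) := Σ_i μ(ξ_i)·λ(B ∩ ξ_i)/λ(ξ_i) for measurable B. Then sup{|μ(B) − μ̄(B)| : B measurable} ≤ C·λ(S). -/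
open MeasureTheory

/-- If `f x ≤ f y + c` for `x ∈ s` and `y ∈ t`, the averages of `f` over `s` and `t` satisfy the
same inequality, stated here without division. -/
theorem withDensity_mul_le_of_forall_le_add {S : Type*} [MeasurableSpace S] {lam : Measure S}
    {f : S → ENNReal} (hf : Measurable f) {c : ENNReal} {s t : Set S}
    (hs : MeasurableSet s) (ht : MeasurableSet t)
    (h : ∀ x ∈ s, ∀ y ∈ t, f x ≤ f y + c) :
    lam.withDensity f s * lam t ≤ (lam.withDensity f t + c * lam t) * lam s := by
  have key : ∀ x ∈ s, f x * lam t ≤ lam.withDensity f t + c * lam t := fun x hx => by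
    calc f x * lam t = ∫⁻ _ in t, f x ∂lam := (setLIntegral_const t (f x)).symm
      _ ≤ ∫⁻ y in t, (f y + c) ∂lam := setLIntegral_mono' ht (h x hx)
      _ = lam.withDensity f t + c * lam t := by
        rw [lintegral_add_left hf, setLIntegral_const, withDensity_apply f ht]
  calc lam.withDensity f s * lam t = ∫⁻ x in s, f x * lam t ∂lam := by
        rw [lintegral_mul_const _ hf, withDensity_apply f hs]
    _ ≤ ∫⁻ _ in s, (lam.withDensity f t + c * lam t) ∂lam := setLIntegral_mono' hs key
    _ = (lam.withDensity f t + c * lam t) * lam s := setLIntegral_const _ _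

theorem withDensity_toReal_mul_le_of_forall_le_add {S : Type*} [MeasurableSpace S]
    {lam : Measure S} [IsFiniteMeasure lam] {f : S → ENNReal} (hf : Measurable f)
    [IsFiniteMeasure (lam.withDensity f)] {C : ℝ} (hC : 0 ≤ C) {s t : Set S}
    (hs : MeasurableSet s) (ht : MeasurableSet t)
    (h : ∀ x ∈ s, ∀ y ∈ t, f x ≤ f y + ENNReal.ofReal C) :
    (lam.withDensity f s).toReal * (lam t).toReal ≤
      ((lam.withDensity f t).toReal + C * (lam t).toReal) * (lam s).toReal := by
  have hfin : ENNReal.ofReal C * lam t ≠ ⊤ :=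
    ENNReal.mul_ne_top ENNReal.ofReal_ne_top (measure_ne_top _ _)
  have := ENNReal.toReal_mono
    (ENNReal.mul_ne_top (ENNReal.add_ne_top.2 ⟨measure_ne_top _ _, hfin⟩) (measure_ne_top _ _))
    (withDensity_mul_le_of_forall_le_add hf hs ht h)
  rwa [ENNReal.toReal_mul, ENNReal.toReal_mul, ENNReal.toReal_add (measure_ne_top _ _) hfin,
    ENNReal.toReal_mul, ENNReal.toReal_ofReal hC] at this

theorem toReal_measure_eq_sum_inter {S ι : Type*} [MeasurableSpace S] [Fintype ι]
    (ν : Measure S) [IsFiniteMeasure ν] {ξ : ι → Set S} (hξmeas : ∀ i, MeasurableSet (ξ i))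
    (hξdisj : Pairwise (Function.onFun Disjoint ξ)) (hξcover : (⋃ i, ξ i) = Set.univ)
    {B : Set S} (hB : MeasurableSet B) :
    (ν B).toReal = ∑ i, (ν (B ∩ ξ i)).toReal := by
  rw [← ENNReal.toReal_sum fun _ _ => measure_ne_top _ _, ← tsum_fintype (L := .unconditional ι),
    ← measure_iUnion (fun i j hij => (hξdisj hij).mono Set.inter_subset_right
      Set.inter_subset_right) fun i => hB.inter (hξmeas i), ← Set.inter_iUnion, hξcover,
    Set.inter_univ]

/-- Let `λ` be a finite measure on `S`, `μ` a probability measure with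
density `f` with respect to `λ`, and `ξ₁, …, ξ_n` a finite measurable partition of `S`
with `λ(ξ_i) > 0` and on each cell of which `f` has oscillation at most `C`. Then the
piecewise-uniform smoothing `μ̄(B) = Σ_i μ(ξ_i)·λ(B ∩ ξ_i)/λ(ξ_i)` satisfies
`sup { |μ(B) − μ̄(B)| : B measurable } ≤ C·λ(S)`. -/
theorem piecewise_uniform_smoothing_error {S : Type*} [MeasurableSpace S]
    (lam : Measure S) [IsFiniteMeasure lam]
    (f : S → ENNReal) (hf : Measurable f)
    (μ : Measure S) [IsProbabilityMeasure μ] (hμ : μ = lam.withDensity f)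
    (n : ℕ) (ξ : Fin n → Set S)
    (hξmeas : ∀ i, MeasurableSet (ξ i))
    (hξdisj : Pairwise (Function.onFun Disjoint ξ))
    (hξcover : (⋃ i, ξ i) = Set.univ)
    (hξpos : ∀ i, 0 < lam (ξ i))
    (C : ℝ) (hC : 0 ≤ C)
    (hosc : ∀ i, ∀ x ∈ ξ i, ∀ y ∈ ξ i, f x ≤ f y + ENNReal.ofReal C) :
    ∀ B : Set S, MeasurableSet B →
      |(μ B).toReal -
          ∑ i, (μ (ξ i)).toReal * (lam (B ∩ ξ i)).toReal / (lam (ξ i)).toReal| ≤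
        C * (lam Set.univ).toReal := by
  subst hμ
  intro B hB
  rw [toReal_measure_eq_sum_inter _ hξmeas hξdisj hξcover hB,
    toReal_measure_eq_sum_inter lam hξmeas hξdisj hξcover MeasurableSet.univ,
    ← Finset.sum_sub_distrib, Finset.mul_sum]
  refine (Finset.abs_sum_le_sum_abs _ _).trans (Finset.sum_le_sum fun i _ => ?_)
  rw [Set.univ_inter]
  have hBi := hB.inter (hξmeas i)
  have hupper := withDensity_toReal_mul_le_of_forall_le_add (lam := lam) hf hC hBi (hξmeas i)
    fun x hx y hy => hosc i x hx.2 y hy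
  have hlower := withDensity_toReal_mul_le_of_forall_le_add (lam := lam) hf hC (hξmeas i) hBi
    fun x hx y hy => hosc i x hx y hy.2
  have hpos : 0 < (lam (ξ i)).toReal := ENNReal.toReal_pos (hξpos i).ne' (measure_ne_top _ _)
  have hle : (lam (B ∩ ξ i)).toReal ≤ (lam (ξ i)).toReal :=
    ENNReal.toReal_mono (measure_ne_top _ _) (measure_mono Set.inter_subset_right)
  have hC_le := mul_le_mul_of_nonneg_right (mul_le_mul_of_nonneg_left hle hC) hpos.le
  rw [sub_div' hpos.ne', abs_div, abs_of_pos hpos, div_le_iff₀ hpos, abs_le]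
  constructor <;> linarith
end

section
/- Let S be a nonempty finite set, and for each s ∈ S let A(s) be a nonempty finite set of actions; write Σ for the set of pairs (s,a) with a ∈ A(s). Let r̃ : Σ → ℝ be a reward function, let θ assign to each (s,a) ∈ Σ a probability vector θ(s,a,·) on S, and suppose that for all (s,a), (s′,a′) ∈ Σ, Σ_{s″ ∈ S} |θ(s,a,s″) − θ(s′,a′,s″)| ≤ 2α′ for some α′ ∈ [0,1]. Then for every v : S → ℝ, the function T v : S → ℝ defined by (T v)(s) := max_{a ∈ A(s)} { r̃(s,a) + Σ_{s′ ∈ S} θ(s,a,s′) v(s′) } satisfies span(T v) ≤ span(r̃) + α′ · span(v). -/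
open Finset

/-- A difference of two vectors of equal total mass integrates `v` to at most half its
`ℓ¹` norm times the span of `v`. -/
lemma sum_mul_sub_sum_mul_le_span {S : Type*} [Fintype S] (p q v : S → ℝ)
    (hpq : ∑ s, p s = ∑ s, q s) :
    ∑ s, p s * v s - ∑ s, q s * v s ≤
      (∑ s, |p s - q s|) / 2 * ((⨆ s, v s) - ⨅ s, v s) := by
  set M := ⨆ s, v s
  set m := ⨅ s, v s
  have hM : ∀ s, v s ≤ M := le_ciSup (Set.finite_range v).bddAbove
  have hm : ∀ s, m ≤ v s := ciInf_le (Set.finite_range v).bddBelow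
  calc ∑ s, p s * v s - ∑ s, q s * v s
      = ∑ s, (p s - q s) * (v s - (M + m) / 2) := by
        simp only [sub_mul, mul_sub, sum_sub_distrib, ← sum_mul, hpq]
        ring
    _ ≤ ∑ s, |p s - q s| * ((M - m) / 2) := by
        refine sum_le_sum fun s _ => (le_abs_self _).trans ?_
        rw [abs_mul]
        gcongr
        rw [abs_le]
        constructor <;> linarith [hM s, hm s]
    _ = (∑ s, |p s - q s|) / 2 * (M - m) := by
        rw [← sum_mul]
        ring

/-- For a finite MDP with state-dependent finite action sets, reward
`r̃`, and transition probabilities `θ` whose rows are pairwise within `2α′` in `ℓ¹`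
distance, the Bellman operator
`(T v)(s) = max_{a ∈ A(s)} { r̃(s,a) + Σ_{s′} θ(s,a,s′) v(s′) }` satisfies
`span(T v) ≤ span(r̃) + α′ · span(v)`. -/
theorem bellman_span_contraction {S A : Type*} [Fintype S] [Nonempty S] [Fintype A]
    (Act : S → Finset A) (hAct : ∀ s, (Act s).Nonempty)
    (rt : S → A → ℝ) (θ : S → A → S → ℝ)
    (hθ0 : ∀ s, ∀ a ∈ Act s, ∀ s'', 0 ≤ θ s a s'')
    (hθ1 : ∀ s, ∀ a ∈ Act s, ∑ s'', θ s a s'' = 1)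
    (α' : ℝ) (hα' : α' ∈ Set.Icc (0 : ℝ) 1)
    (hDoeblin : ∀ s, ∀ a ∈ Act s, ∀ s', ∀ a' ∈ Act s',
      ∑ s'', |θ s a s'' - θ s' a' s''| ≤ 2 * α')
    (v : S → ℝ) :
    (⨆ s : S, ⨆ a : (Act s), (rt s a.1 + ∑ s', θ s a.1 s' * v s')) -
        (⨅ s : S, ⨆ a : (Act s), (rt s a.1 + ∑ s', θ s a.1 s' * v s')) ≤
      ((⨆ q : {q : S × A // q.2 ∈ Act q.1}, rt q.1.1 q.1.2) -
          ⨅ q : {q : S × A // q.2 ∈ Act q.1}, rt q.1.1 q.1.2) +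
        α' * ((⨆ s : S, v s) - ⨅ s : S, v s) := by
  have : ∀ s, Nonempty (Act s) := fun s => (hAct s).to_subtype
  obtain ⟨s₁, h₁⟩ := exists_eq_ciSup_of_finite
    (f := fun s : S => ⨆ a : (Act s), (rt s a.1 + ∑ s', θ s a.1 s' * v s'))
  obtain ⟨s₂, h₂⟩ := exists_eq_ciInf_of_finite
    (f := fun s : S => ⨆ a : (Act s), (rt s a.1 + ∑ s', θ s a.1 s' * v s'))
  obtain ⟨a₁, ha₁⟩ := exists_eq_ciSup_of_finite
    (f := fun a : (Act s₁) => rt s₁ a.1 + ∑ s', θ s₁ a.1 s' * v s')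
  obtain ⟨a₂, ha₂⟩ := hAct s₂
  have hT₂ : rt s₂ a₂ + ∑ s', θ s₂ a₂ s' * v s' ≤
      ⨆ a : (Act s₂), (rt s₂ a.1 + ∑ s', θ s₂ a.1 s' * v s') :=
    le_ciSup (f := fun a : (Act s₂) => rt s₂ a.1 + ∑ s', θ s₂ a.1 s' * v s')
      (Set.finite_range _).bddAbove ⟨a₂, ha₂⟩
  have hr₁ := le_ciSup (f := fun q : {q : S × A // q.2 ∈ Act q.1} => rt q.1.1 q.1.2)
    (Set.finite_range _).bddAbove ⟨(s₁, a₁.1), a₁.2⟩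
  have hr₂ := ciInf_le (f := fun q : {q : S × A // q.2 ∈ Act q.1} => rt q.1.1 q.1.2)
    (Set.finite_range _).bddBelow ⟨(s₂, a₂), ha₂⟩
  have hspan : 0 ≤ (⨆ s : S, v s) - ⨅ s : S, v s :=
    sub_nonneg.2 (ciInf_le_ciSup (Set.finite_range v).bddBelow (Set.finite_range v).bddAbove)
  have hθ := sum_mul_sub_sum_mul_le_span (θ s₁ a₁.1) (θ s₂ a₂) v
    ((hθ1 s₁ a₁.1 a₁.2).trans (hθ1 s₂ a₂ ha₂).symm)
  have hα := mul_le_mul_of_nonneg_right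
    (show (∑ s, |θ s₁ a₁.1 s - θ s₂ a₂ s|) / 2 ≤ α' by
      linarith [hDoeblin s₁ a₁.1 a₁.2 s₂ a₂ ha₂]) hspan
  rw [← h₁, ← h₂, ← ha₁]
  linarith
end

section
/- Let S be a measurable space and κ a Markov kernel on S satisfying ‖κ(s) − κ(s′)‖_TV ≤ 2α for all s, s′ ∈ S with α ∈ (0,1), with unique invariant probability measure μ∞. Let (s_t)_{t≥0} be the Markov chain with transition kernel κ started from an arbitrary initial state, defined on its canonical trajectory space. Let ξ ⊆ S be measurable with μ∞(ξ) ≥ c for some c ∈ (0,1], let t⋆ := ⌈ log(2/c) / log(1/α) ⌉, let δ ∈ (0,1), and let H ∈ ℕ with H ≥ 2·t⋆. Then with probability at least 1 − δ/2, the number of visits n := Σ_{t=0}^{H−1} 1{s_t ∈ ξ} of the chain to ξ during the first H steps satisfies n ≥ H·μ∞(ξ)/(2·t⋆) − √( (H/t⋆)·log(4H/(t⋆·δ)) ) − 1. -/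
open MeasureTheory

lemma measureReal_sub_le_of_tvDist_le {S : Type*} [MeasurableSpace S] {P Q : Measure S}
    [IsProbabilityMeasure P] [IsProbabilityMeasure Q] {α : ℝ} (h : tvDist P Q ≤ 2 * α)
    {B : Set S} (hB : MeasurableSet B) : P.real B - Q.real B ≤ α := by
  have hbdd : BddAbove (Set.range fun B : {B : Set S // MeasurableSet B} =>
      |(P B.1).toReal - (Q B.1).toReal|) := by
    refine ⟨1, ?_⟩
    rintro _ ⟨C, rfl⟩
    have h1 : P.real C.1 ≤ 1 := measureReal_le_one
    have h2 : Q.real C.1 ≤ 1 := measureReal_le_one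
    have h3 : 0 ≤ P.real C.1 := measureReal_nonneg
    have h4 : 0 ≤ Q.real C.1 := measureReal_nonneg
    simp only [measureReal_def] at h1 h2 h3 h4
    exact abs_le.2 ⟨by linarith, by linarith⟩
  have h1 := le_ciSup hbdd ⟨B, hB⟩
  have h2 := le_abs_self (P.real B - Q.real B)
  simp only [measureReal_def] at h2 ⊢
  unfold tvDist at h
  dsimp only at h1
  linarith

lemma integral_sub_integral_le_mul {S : Type*} [MeasurableSpace S] {P Q : Measure S}
    [IsProbabilityMeasure P] [IsProbabilityMeasure Q] {α : ℝ}
    (h : ∀ B, MeasurableSet B → P.real B - Q.real B ≤ α)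
    {f : S → ℝ} (hf : Measurable f) {a D : ℝ} (ha : ∀ x, a ≤ f x) (hD : ∀ x, f x ≤ a + D) :
    ∫ x, f x ∂P - ∫ x, f x ∂Q ≤ α * D := by
  have hg : Measurable fun x => f x - a := hf.sub_const a
  have hg0 : ∀ x, 0 ≤ f x - a := fun x => sub_nonneg.2 (ha x)
  have hgD : ∀ x, f x - a ≤ D := fun x => by linarith [hD x]
  have hD0 : 0 ≤ D := by
    obtain ⟨x⟩ := nonempty_of_isProbabilityMeasure P
    exact (hg0 x).trans (hgD x)
  have hint : ∀ (ρ : Measure S) [IsProbabilityMeasure ρ], Integrable (fun x => f x - a) ρ := by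
    intro ρ _
    refine .of_bound hg.aestronglyMeasurable D (.of_forall fun x => ?_)
    rw [Real.norm_of_nonneg (hg0 x)]
    exact hgD x
  have hlayer : ∀ (ρ : Measure S) [IsProbabilityMeasure ρ],
      (∫ x, f x ∂ρ) - a = ∫ t in Set.Ioc 0 D, ρ.real {x | t ≤ f x - a} := by
    intro ρ _
    rw [← (hint ρ).integral_eq_integral_Ioc_meas_le (.of_forall hg0) (.of_forall hgD),
      integral_sub _ (integrable_const a)]
    · simp
    · exact ((hint ρ).add (integrable_const a)).congr (.of_forall fun x => by simp)
  have hanti : ∀ (ρ : Measure S) [IsProbabilityMeasure ρ],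
      IntegrableOn (fun t => ρ.real {x | t ≤ f x - a}) (Set.Ioc 0 D) volume := by
    intro ρ _
    have hm : Antitone fun t => ρ.real {x | t ≤ f x - a} := fun s t hst =>
      measureReal_mono fun x hx => le_trans hst hx
    refine .of_bound (by simp) hm.measurable.aestronglyMeasurable 1 (.of_forall fun t => ?_)
    rw [Real.norm_of_nonneg measureReal_nonneg]
    exact measureReal_le_one
  calc ∫ x, f x ∂P - ∫ x, f x ∂Q
      = ∫ t in Set.Ioc 0 D, (P.real {x | t ≤ f x - a} - Q.real {x | t ≤ f x - a}) := by
        rw [integral_sub (hanti P) (hanti Q), ← hlayer P, ← hlayer Q]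
        ring
    _ ≤ ∫ t in Set.Ioc 0 D, α := by
        refine setIntegral_mono ((hanti P).sub (hanti Q)) (by simp) fun t => ?_
        exact h _ (measurableSet_le measurable_const hg)
    _ = α * D := by simp [hD0, mul_comm]

lemma integral_measure_comp {S : Type*} [MeasurableSpace S] {ν : Measure S}
    {K : ProbabilityTheory.Kernel S S} {f : S → ℝ} (hf : Integrable f (ν.bind K)) :
    ∫ x, f x ∂(ν.bind K) = ∫ x, ∫ y, f y ∂K x ∂ν := by
  rw [Measure.comp_eq_comp_const_apply] at hf ⊢
  rw [ProbabilityTheory.Kernel.integral_comp hf]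
  simp

/-- The action of a kernel on real functions. -/
noncomputable def kernelAverage {S : Type*} [MeasurableSpace S] (κ : S → Measure S)
    (f : S → ℝ) : S → ℝ :=
  fun x => ∫ y, f y ∂κ x

section

variable {S : Type*} [MeasurableSpace S] {κ : S → Measure S}

lemma measurable_kernelAverage (hκm : Measurable κ) (hκp : ∀ s, IsProbabilityMeasure (κ s))
    {f : S → ℝ} (hf : Measurable f) : Measurable (kernelAverage κ f) := by
  let K : ProbabilityTheory.Kernel S S := ⟨κ, hκm⟩
  have : ProbabilityTheory.IsMarkovKernel K := ⟨hκp⟩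
  exact (StronglyMeasurable.integral_kernel (κ := K) hf.stronglyMeasurable).measurable

lemma kernelAverage_mem_Icc (hκp : ∀ s, IsProbabilityMeasure (κ s))
    {f : S → ℝ} (h : ∀ x, f x ∈ Set.Icc (0 : ℝ) 1) (x : S) :
    kernelAverage κ f x ∈ Set.Icc (0 : ℝ) 1 := by
  have := hκp x
  refine ⟨integral_nonneg fun y => (h y).1, ?_⟩
  calc ∫ y, f y ∂κ x ≤ ∫ _, (1 : ℝ) ∂κ x := by
        refine integral_mono_of_nonneg (.of_forall fun y => (h y).1) (integrable_const 1)
          (.of_forall fun y => (h y).2)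
    _ = 1 := by simp

lemma measurable_iterate_kernelAverage (hκm : Measurable κ)
    (hκp : ∀ s, IsProbabilityMeasure (κ s)) {f : S → ℝ} (hf : Measurable f) (n : ℕ) :
    Measurable ((kernelAverage κ)^[n] f) := by
  induction n with
  | zero => exact hf
  | succ n ih =>
    rw [Function.iterate_succ_apply']
    exact measurable_kernelAverage hκm hκp ih

lemma iterate_kernelAverage_mem_Icc (hκp : ∀ s, IsProbabilityMeasure (κ s)) {f : S → ℝ}
    (h : ∀ x, f x ∈ Set.Icc (0 : ℝ) 1) (n : ℕ) (x : S) :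
    (kernelAverage κ)^[n] f x ∈ Set.Icc (0 : ℝ) 1 := by
  induction n generalizing x with
  | zero => exact h x
  | succ n ih =>
    rw [Function.iterate_succ_apply']
    exact kernelAverage_mem_Icc hκp ih x

lemma iterate_kernelAverage_sub_le (hκm : Measurable κ)
    (hκp : ∀ s, IsProbabilityMeasure (κ s)) {α : ℝ}
    (hDoeblin : ∀ s s' : S, tvDist (κ s) (κ s') ≤ 2 * α) {f : S → ℝ} (hf : Measurable f)
    (h : ∀ x, f x ∈ Set.Icc (0 : ℝ) 1) (n : ℕ) (x y : S) :
    (kernelAverage κ)^[n] f x - (kernelAverage κ)^[n] f y ≤ α ^ n := by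
  induction n generalizing x y with
  | zero =>
    simp only [Function.iterate_zero, id_eq, pow_zero]
    linarith [(h x).2, (h y).1]
  | succ n ih =>
    have := hκp x
    have := hκp y
    have : Nonempty S := ⟨x⟩
    have hmem := iterate_kernelAverage_mem_Icc hκp h n
    set g := (kernelAverage κ)^[n] f with hg
    rw [Function.iterate_succ_apply', ← hg, pow_succ']
    have hbdd : BddBelow (Set.range g) := ⟨0, by rintro _ ⟨z, rfl⟩; exact (hmem z).1⟩
    refine integral_sub_integral_le_mul
      (fun B hB => measureReal_sub_le_of_tvDist_le (hDoeblin x y) hB)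
      (measurable_iterate_kernelAverage hκm hκp hf n) (a := ⨅ z, g z) (ciInf_le hbdd) fun z => ?_
    have : g z - α ^ n ≤ ⨅ z, g z := le_ciInf fun w => by linarith [ih z w]
    linarith

lemma integral_iterate_kernelAverage (hκm : Measurable κ)
    (hκp : ∀ s, IsProbabilityMeasure (κ s)) {ν : Measure S} [IsProbabilityMeasure ν]
    (hinv : ν.bind κ = ν) {f : S → ℝ} (hf : Measurable f)
    (h : ∀ x, f x ∈ Set.Icc (0 : ℝ) 1) (n : ℕ) :
    ∫ x, (kernelAverage κ)^[n] f x ∂ν = ∫ x, f x ∂ν := by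
  induction n with
  | zero => rfl
  | succ n ih =>
    let K : ProbabilityTheory.Kernel S S := ⟨κ, hκm⟩
    have : ProbabilityTheory.IsMarkovKernel K := ⟨hκp⟩
    have hmem := iterate_kernelAverage_mem_Icc hκp h n
    have hinv' : ν.bind K = ν := hinv
    rw [← ih]
    conv_rhs => rw [← hinv']
    rw [integral_measure_comp]
    · simp only [Function.iterate_succ_apply']
      rfl
    · rw [hinv']
      refine .of_bound (measurable_iterate_kernelAverage hκm hκp hf n).aestronglyMeasurable 1
        (.of_forall fun x => ?_)
      rw [Real.norm_of_nonneg (hmem x).1]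
      exact (hmem x).2

/-- A Doeblin chain visits `ξ` after `n` steps with probability at least `ν ξ - α ^ n`. -/
lemma sub_pow_le_iterate_kernelAverage (hκm : Measurable κ)
    (hκp : ∀ s, IsProbabilityMeasure (κ s)) {α : ℝ}
    (hDoeblin : ∀ s s' : S, tvDist (κ s) (κ s') ≤ 2 * α) {ν : Measure S} [IsProbabilityMeasure ν]
    (hinv : ν.bind κ = ν) {f : S → ℝ} (hf : Measurable f)
    (h : ∀ x, f x ∈ Set.Icc (0 : ℝ) 1) (n : ℕ) (x : S) :
    ∫ y, f y ∂ν - α ^ n ≤ (kernelAverage κ)^[n] f x := by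
  rw [← integral_iterate_kernelAverage hκm hκp hinv hf h n, sub_le_iff_le_add]
  calc ∫ y, (kernelAverage κ)^[n] f y ∂ν
      ≤ ∫ _, ((kernelAverage κ)^[n] f x + α ^ n) ∂ν := by
        refine integral_mono_of_nonneg
          (.of_forall fun y => (iterate_kernelAverage_mem_Icc hκp h n y).1)
          (integrable_const _) (.of_forall fun y => ?_)
        have := iterate_kernelAverage_sub_le hκm hκp hDoeblin hf h n y x
        dsimp only
        linarith
    _ = _ := by simp

end

/-- The σ-algebra generated by the process up to time `t`. -/
abbrev pastSigma {S Ω : Type*} [MeasurableSpace S] (X : ℕ → Ω → S) (t : ℕ) :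
    MeasurableSpace Ω :=
  ⨆ i ≤ t, MeasurableSpace.comap (X i) inferInstance

section

variable {S Ω : Type*} [MeasurableSpace S] {X : ℕ → Ω → S}

lemma pastSigma_mono {s t : ℕ} (hst : s ≤ t) : pastSigma X s ≤ pastSigma X t :=
  iSup₂_le fun i hi => le_iSup₂_of_le i (hi.trans hst) le_rfl

lemma measurable_pastSigma {s t : ℕ} (hst : s ≤ t) : Measurable[pastSigma X t] (X s) :=
  Measurable.of_comap_le <|
    le_iSup₂_of_le (f := fun i (_ : i ≤ t) => MeasurableSpace.comap (X i) inferInstance) s hst le_rfl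

variable [mΩ : MeasurableSpace Ω] {μ : Measure Ω} [IsProbabilityMeasure μ] {κ : S → Measure S}

lemma pastSigma_le (hXmeas : ∀ t, Measurable (X t)) (t : ℕ) : pastSigma X t ≤ mΩ :=
  iSup₂_le fun i _ => (hXmeas i).comap_le

lemma integrable_of_mem_Icc {f : Ω → ℝ} (hf : Measurable f) (h : ∀ ω, f ω ∈ Set.Icc (0 : ℝ) 1) :
    Integrable f μ :=
  .of_bound hf.aestronglyMeasurable 1 <| .of_forall fun ω => by
    rw [Real.norm_of_nonneg (h ω).1]
    exact (h ω).2

lemma integral_mul_comp_succ (hκm : Measurable κ) (hκp : ∀ s, IsProbabilityMeasure (κ s))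
    (hXmeas : ∀ t, Measurable (X t))
    (hMarkov : ∀ (t : ℕ) (B : Set S), MeasurableSet B →
      μ[(fun ω => Set.indicator B (fun _ => (1 : ℝ)) (X (t + 1) ω)) | pastSigma X t]
        =ᵐ[μ] fun ω => (κ (X t ω) B).toReal)
    {t : ℕ} {G : Ω → ℝ} (hG : Measurable[pastSigma X t] G) (hG01 : ∀ ω, G ω ∈ Set.Icc (0 : ℝ) 1)
    {f : S → ℝ} (hf : Measurable f) (hf01 : ∀ x, f x ∈ Set.Icc (0 : ℝ) 1) :
    ∫ ω, G ω * f (X (t + 1) ω) ∂μ = ∫ ω, G ω * kernelAverage κ f (X t ω) ∂μ := by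
  have hm := pastSigma_le hXmeas t
  have hG' : Measurable G := hG.mono hm le_rfl
  let K : ProbabilityTheory.Kernel S S := ⟨κ, hκm⟩
  have : ProbabilityTheory.IsMarkovKernel K := ⟨hκp⟩
  have hGi : Integrable G μ := integrable_of_mem_Icc hG' hG01
  have hset : ∀ B, MeasurableSet B →
      ∫ ω, G ω * B.indicator (fun _ => (1 : ℝ)) (X (t + 1) ω) ∂μ
        = ∫ ω, G ω * (κ (X t ω)).real B ∂μ := by
    intro B hB
    have hind : Measurable fun ω => B.indicator (fun _ => (1 : ℝ)) (X (t + 1) ω) :=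
      (measurable_const.indicator hB).comp (hXmeas _)
    have hind01 : ∀ ω, B.indicator (fun _ => (1 : ℝ)) (X (t + 1) ω) ∈ Set.Icc (0 : ℝ) 1 :=
      fun ω => by by_cases h : X (t + 1) ω ∈ B <;> simp [h]
    have hpull := condExp_mul_of_stronglyMeasurable_left (μ := μ) hG.stronglyMeasurable
      (g := fun ω => B.indicator (fun _ => (1 : ℝ)) (X (t + 1) ω))
      (integrable_of_mem_Icc (hG'.mul hind) fun ω =>
        ⟨mul_nonneg (hG01 ω).1 (hind01 ω).1,
          mul_le_one₀ (hG01 ω).2 (hind01 ω).1 (hind01 ω).2⟩)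
      (integrable_of_mem_Icc hind hind01)
    refine (integral_condExp hm).symm.trans (integral_congr_ae ?_)
    filter_upwards [hpull, hMarkov t B hB] with ω h1 h2
    refine h1.trans ?_
    rw [Pi.mul_apply, h2, measureReal_def]
  let W : Measure Ω := μ.withDensity fun ω => ENNReal.ofReal (G ω)
  have hWfin : IsFiniteMeasure W := isFiniteMeasure_withDensity_ofReal hGi.2
  have hWint : ∀ g : Ω → ℝ, ∫ ω, g ω ∂W = ∫ ω, G ω * g ω ∂μ := by
    intro g
    rw [integral_withDensity_eq_integral_toReal_smul hG'.ennreal_ofReal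
      (.of_forall fun ω => ENNReal.ofReal_lt_top)]
    exact integral_congr_ae (.of_forall fun ω => by simp [ENNReal.toReal_ofReal (hG01 ω).1])
  have hbind : W.map (X (t + 1)) = (W.map (X t)).bind K := by
    ext B hB
    have hKB : Measurable fun x => (κ x).real B := (Measure.measurable_measure.1 hκm B hB).ennreal_toReal
    rw [← ENNReal.toReal_eq_toReal_iff' (measure_ne_top _ _) (measure_ne_top _ _),
      ← measureReal_def, ← measureReal_def, ← integral_indicator_one hB,
      ← integral_indicator_one hB, integral_measure_comp, integral_map (hXmeas _).aemeasurable,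
      integral_map (hXmeas _).aemeasurable, hWint, hWint]
    · have h1 : ∀ x, ∫ y, B.indicator (1 : S → ℝ) y ∂K x = (κ x).real B :=
        fun x => integral_indicator_one hB
      simp only [h1]
      exact hset B hB
    · have h1 : ∀ x, ∫ y, B.indicator (1 : S → ℝ) y ∂K x = (κ x).real B :=
        fun x => integral_indicator_one hB
      simp only [h1]
      exact hKB.aestronglyMeasurable
    · exact (measurable_one.indicator hB).aestronglyMeasurable
    · exact (integrable_const (1 : ℝ)).indicator hB
  have hKf := measurable_kernelAverage hκm hκp hf
  rw [← hWint, ← hWint, ← integral_map (hXmeas _).aemeasurable hf.aestronglyMeasurable,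
    ← integral_map (hXmeas _).aemeasurable hKf.aestronglyMeasurable, hbind, integral_measure_comp]
  · rfl
  · refine .of_bound hf.aestronglyMeasurable 1 (.of_forall fun x => ?_)
    rw [Real.norm_of_nonneg (hf01 x).1]
    exact (hf01 x).2

lemma integral_mul_comp_add (hκm : Measurable κ) (hκp : ∀ s, IsProbabilityMeasure (κ s))
    (hXmeas : ∀ t, Measurable (X t))
    (hMarkov : ∀ (t : ℕ) (B : Set S), MeasurableSet B →
      μ[(fun ω => Set.indicator B (fun _ => (1 : ℝ)) (X (t + 1) ω)) | pastSigma X t]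
        =ᵐ[μ] fun ω => (κ (X t ω) B).toReal)
    {t : ℕ} {G : Ω → ℝ} (hG : Measurable[pastSigma X t] G) (hG01 : ∀ ω, G ω ∈ Set.Icc (0 : ℝ) 1)
    {f : S → ℝ} (hf : Measurable f) (hf01 : ∀ x, f x ∈ Set.Icc (0 : ℝ) 1) (n : ℕ) :
    ∫ ω, G ω * f (X (t + n) ω) ∂μ = ∫ ω, G ω * (kernelAverage κ)^[n] f (X t ω) ∂μ := by
  induction n generalizing f with
  | zero => rfl
  | succ n ih =>
    rw [← Nat.add_assoc, integral_mul_comp_succ hκm hκp hXmeas hMarkov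
      (hG.mono (pastSigma_mono (Nat.le_add_right t n)) le_rfl) hG01 hf hf01,
      ih (measurable_kernelAverage hκm hκp hf) (kernelAverage_mem_Icc hκp hf01)]
    rfl

/-- Exponential moment of the number of visits to `ξ` at times `d, 2 d, …, m d`. -/
lemma integral_exp_neg_visits_le (hκm : Measurable κ) (hκp : ∀ s, IsProbabilityMeasure (κ s))
    (hXmeas : ∀ t, Measurable (X t))
    (hMarkov : ∀ (t : ℕ) (B : Set S), MeasurableSet B →
      μ[(fun ω => Set.indicator B (fun _ => (1 : ℝ)) (X (t + 1) ω)) | pastSigma X t]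
        =ᵐ[μ] fun ω => (κ (X t ω) B).toReal)
    {ξ : Set S} (hξ : MeasurableSet ξ) {d : ℕ} {q : ℝ} (hq : q ≤ 1)
    (hvisit : ∀ x, q ≤ (kernelAverage κ)^[d] (ξ.indicator fun _ => (1 : ℝ)) x)
    {l : ℝ} (hl : 0 ≤ l) (m : ℕ) :
    ∫ ω, Real.exp (-l * ∑ k ∈ Finset.range m,
        ξ.indicator (fun _ => (1 : ℝ)) (X ((k + 1) * d) ω)) ∂μ
      ≤ (1 - q * (1 - Real.exp (-l))) ^ m := by
  have hf : Measurable (ξ.indicator fun _ => (1 : ℝ)) := measurable_const.indicator hξ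
  have hf01 : ∀ x, ξ.indicator (fun _ => (1 : ℝ)) x ∈ Set.Icc (0 : ℝ) 1 :=
    fun x => by by_cases h : x ∈ ξ <;> simp [h]
  have he0 : 0 < Real.exp (-l) := Real.exp_pos _
  have he1 : Real.exp (-l) ≤ 1 := Real.exp_le_one_iff.2 (by linarith)
  induction m with
  | zero => simp
  | succ m ih =>
    set G : Ω → ℝ := fun ω => Real.exp (-l * ∑ k ∈ Finset.range m,
        ξ.indicator (fun _ => (1 : ℝ)) (X ((k + 1) * d) ω)) with hGdef
    have hG : Measurable[pastSigma X (m * d)] G := by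
      refine Real.measurable_exp.comp (Measurable.const_mul ?_ _)
      refine Finset.measurable_fun_sum _ fun k hk => hf.comp (measurable_pastSigma ?_)
      exact Nat.mul_le_mul_right d (Finset.mem_range.1 hk)
    have hG01 : ∀ ω, G ω ∈ Set.Icc (0 : ℝ) 1 := fun ω => by
      refine ⟨(Real.exp_pos _).le, Real.exp_le_one_iff.2 ?_⟩
      have : 0 ≤ ∑ k ∈ Finset.range m, ξ.indicator (fun _ => (1 : ℝ)) (X ((k + 1) * d) ω) :=
        Finset.sum_nonneg fun k _ => (hf01 _).1
      nlinarith
    have hG' : Measurable G := hG.mono (pastSigma_le hXmeas _) le_rfl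
    have hGi : Integrable G μ := integrable_of_mem_Icc hG' hG01
    have hprod : ∀ {g : S → ℝ}, Measurable g → (∀ x, g x ∈ Set.Icc (0 : ℝ) 1) → ∀ t,
        Integrable (fun ω => G ω * g (X t ω)) μ := fun hg hg01 t =>
      integrable_of_mem_Icc (hG'.mul (hg.comp (hXmeas t))) fun ω =>
        ⟨mul_nonneg (hG01 ω).1 (hg01 _).1, mul_le_one₀ (hG01 ω).2 (hg01 _).1 (hg01 _).2⟩
    have hlower : q * ∫ ω, G ω ∂μ
        ≤ ∫ ω, G ω * ξ.indicator (fun _ => (1 : ℝ)) (X (m * d + d) ω) ∂μ := by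
      rw [integral_mul_comp_add hκm hκp hXmeas hMarkov hG hG01 hf hf01, mul_comm,
        ← integral_mul_const]
      exact integral_mono (hGi.mul_const q)
        (hprod (measurable_iterate_kernelAverage hκm hκp hf d)
          (iterate_kernelAverage_mem_Icc hκp hf01 d) _)
        fun ω => mul_le_mul_of_nonneg_left (hvisit _) (hG01 ω).1
    have hstep : ∀ ω, Real.exp (-l * ∑ k ∈ Finset.range (m + 1),
        ξ.indicator (fun _ => (1 : ℝ)) (X ((k + 1) * d) ω))
        = G ω - (1 - Real.exp (-l)) *
            (G ω * ξ.indicator (fun _ => (1 : ℝ)) (X (m * d + d) ω)) := fun ω => by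
      rw [Finset.sum_range_succ, mul_add, Real.exp_add, Nat.add_mul, Nat.one_mul]
      by_cases h : X (m * d + d) ω ∈ ξ
      · simp only [h, Set.indicator_of_mem, mul_one, hGdef]
        ring
      · simp [h, hGdef]
    simp only [hstep]
    rw [integral_sub hGi ((hprod hf hf01 _).const_mul _), integral_const_mul, pow_succ]
    calc _ ≤ (∫ ω, G ω ∂μ) - (1 - Real.exp (-l)) * (q * ∫ ω, G ω ∂μ) := by
          gcongr
      _ = (∫ ω, G ω ∂μ) * (1 - q * (1 - Real.exp (-l))) := by ring
      _ ≤ _ := by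
          refine mul_le_mul_of_nonneg_right ih ?_
          nlinarith

end

lemma exp_neg_le_quadratic {l : ℝ} (hl : 0 ≤ l) : Real.exp (-l) ≤ 1 - l + l ^ 2 / 2 := by
  have h1 := Real.quadratic_le_exp_of_nonneg hl
  rw [Real.exp_neg, inv_le_iff_one_le_mul₀ (Real.exp_pos l)]
  nlinarith [sq_nonneg (l - 1), sq_nonneg (l ^ 2)]

lemma pow_ceil_log_le {α c : ℝ} (hα : α ∈ Set.Ioo (0 : ℝ) 1) (hc : 0 < c) :
    α ^ ⌈Real.log (2 / c) / Real.log (1 / α)⌉₊ ≤ c / 2 := by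
  set n := ⌈Real.log (2 / c) / Real.log (1 / α)⌉₊
  have hlog : 0 < Real.log (1 / α) := Real.log_pos ((one_lt_div hα.1).2 hα.2)
  have h : Real.log (2 / c) ≤ n * Real.log (1 / α) := (div_le_iff₀ hlog).1 (Nat.le_ceil _)
  rw [← Real.log_le_log_iff (pow_pos hα.1 n) (by positivity), Real.log_pow]
  rw [one_div, Real.log_inv, ← inv_div, Real.log_inv] at h
  linarith

/-- The Chernoff exponent: with `l = 2 e / M` and `e ^ 2 = M L`, the moment bound is `exp (-L)`. -/
lemma chernoff_exponent_le {q M L e : ℝ} (hq : q ∈ Set.Icc (0 : ℝ) (1 / 2)) (hM : 0 < M)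
    (he : e ^ 2 = M * L) (he0 : 0 ≤ e) {m : ℕ} (hm : (m : ℝ) ≤ M) :
    (1 - q * (1 - Real.exp (-(2 * e / M)))) ^ m * Real.exp ((2 * e / M) * (m * q - e))
      ≤ Real.exp (-L) := by
  set l := 2 * e / M with hl
  have hl0 : 0 ≤ l := by positivity
  have hbase : 1 - q * (1 - Real.exp (-l)) ≤ Real.exp (-(q * (l - l ^ 2 / 2))) := by
    refine le_trans ?_ (Real.one_sub_le_exp_neg _)
    nlinarith [exp_neg_le_quadratic hl0, hq.1]
  have hbase0 : 0 ≤ 1 - q * (1 - Real.exp (-l)) := by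
    nlinarith [Real.exp_pos (-l), hq.1, hq.2]
  refine (mul_le_mul_of_nonneg_right (pow_le_pow_left₀ hbase0 hbase m)
    (Real.exp_pos _).le).trans ?_
  rw [← Real.exp_nat_mul, ← Real.exp_add, Real.exp_le_exp]
  have h1 : (m : ℝ) * q ≤ M * (1 / 2) := mul_le_mul hm hq.2 hq.1 hM.le
  have h2 : (m : ℝ) * q * (l ^ 2 / 2) ≤ M * (1 / 2) * (l ^ 2 / 2) :=
    mul_le_mul_of_nonneg_right h1 (by positivity)
  have h3 : M * (1 / 2) * (l ^ 2 / 2) - l * e = -L := by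
    rw [hl]
    field_simp
    nlinarith
  linarith

lemma sum_multiples_le_sum_range {f : ℕ → ℝ} (hf : ∀ t, 0 ≤ f t) {d m H : ℕ} (hd : 0 < d)
    (hm : m * d < H) :
    ∑ k ∈ Finset.range m, f ((k + 1) * d) ≤ ∑ t ∈ Finset.range H, f t := by
  have hinj : Set.InjOn (fun k => (k + 1) * d) (Finset.range m : Set ℕ) := fun a _ b _ hab => by
    simpa using Nat.eq_of_mul_eq_mul_right hd hab
  rw [← Finset.sum_image (g := fun k => (k + 1) * d) (f := f) hinj]
  refine Finset.sum_le_sum_of_subset_of_nonneg (fun t ht => ?_) fun t _ _ => hf t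
  obtain ⟨k, hk, rfl⟩ := Finset.mem_image.1 ht
  exact Finset.mem_range.2
    ((Nat.mul_le_mul_right d (Finset.mem_range.1 hk)).trans_lt hm)

/-- Let `κ` be a Doeblin Markov kernel with invariant probability
measure `μ∞`, and let `(X_t)` be a Markov chain with transition kernel `κ` started from
an arbitrary initial state `s₀` (the Markov property is expressed through conditional
expectations with respect to the natural filtration of the chain). Let `ξ` be measurable
with `μ∞(ξ) ≥ c`, `t⋆ = ⌈log(2/c)/log(1/α)⌉`, `δ ∈ (0,1)` and `H ≥ 2 t⋆`. Then with
probability at least `1 − δ/2`, the number of visits `n = Σ_{t<H} 1{X_t ∈ ξ}` satisfies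
`n ≥ H μ∞(ξ)/(2 t⋆) − √((H/t⋆) log(4H/(t⋆ δ))) − 1`. -/
theorem visit_count_lower_bound {S : Type*} [MeasurableSpace S]
    (κ : S → Measure S) (hκm : Measurable κ)
    (hκp : ∀ s, IsProbabilityMeasure (κ s))
    (α : ℝ) (hα : α ∈ Set.Ioo (0 : ℝ) 1)
    (hDoeblin : ∀ s s' : S, tvDist (κ s) (κ s') ≤ 2 * α)
    (μinf : Measure S) [IsProbabilityMeasure μinf] (hinv : μinf.bind κ = μinf)
    {Ω : Type*} [MeasurableSpace Ω] (μ : Measure Ω) [IsProbabilityMeasure μ]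
    (X : ℕ → Ω → S) (hXmeas : ∀ t, Measurable (X t))
    (s₀ : S) (hstart : ∀ ω, X 0 ω = s₀)
    (hMarkov : ∀ (t : ℕ) (B : Set S), MeasurableSet B →
      μ[(fun ω => Set.indicator B (fun _ => (1 : ℝ)) (X (t + 1) ω)) |
          ⨆ i ≤ t, MeasurableSpace.comap (X i) inferInstance]
        =ᵐ[μ] fun ω => (κ (X t ω) B).toReal)
    (ξ : Set S) (hξ : MeasurableSet ξ)
    (c : ℝ) (hc : c ∈ Set.Ioc (0 : ℝ) 1) (hμξ : c ≤ (μinf ξ).toReal)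
    (tstar : ℕ) (htstar : tstar = ⌈Real.log (2 / c) / Real.log (1 / α)⌉₊)
    (δ : ℝ) (hδ : δ ∈ Set.Ioo (0 : ℝ) 1)
    (H : ℕ) (hH : 2 * tstar ≤ H) :
    ENNReal.ofReal (1 - δ / 2) ≤
      μ {ω | (H : ℝ) * (μinf ξ).toReal / (2 * tstar) -
          Real.sqrt (((H : ℝ) / tstar) * Real.log (4 * H / (tstar * δ))) - 1 ≤
          ∑ t ∈ Finset.range H, Set.indicator ξ (fun _ => (1 : ℝ)) (X t ω)} := by
  set p := (μinf ξ).toReal with hp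
  have hp0 : 0 < p := hc.1.trans_le hμξ
  have hp1 : p ≤ 1 := measureReal_le_one
  have hd : 0 < tstar := by
    rw [htstar, Nat.ceil_pos]
    refine div_pos (Real.log_pos ?_) (Real.log_pos ((one_lt_div hα.1).2 hα.2))
    rw [lt_div_iff₀ hc.1]
    linarith [hc.2]
  have hdR : (0 : ℝ) < tstar := Nat.cast_pos.2 hd
  have hHR : 2 * (tstar : ℝ) ≤ H := by exact_mod_cast hH
  have hH0 : (0 : ℝ) < H := by linarith
  have hpow : α ^ tstar ≤ p / 2 := by
    rw [htstar]
    exact (pow_ceil_log_le hα hc.1).trans (by linarith)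
  have hf01 : ∀ x, ξ.indicator (fun _ => (1 : ℝ)) x ∈ Set.Icc (0 : ℝ) 1 :=
    fun x => by by_cases h : x ∈ ξ <;> simp [h]
  have hf : Measurable (ξ.indicator fun _ => (1 : ℝ)) := measurable_const.indicator hξ
  have hvisit : ∀ x, p / 2 ≤ (kernelAverage κ)^[tstar] (ξ.indicator fun _ => (1 : ℝ)) x := by
    intro x
    have h := sub_pow_le_iterate_kernelAverage hκm hκp hDoeblin hinv hf hf01 tstar x
    have hint : ∫ y, ξ.indicator (fun _ => (1 : ℝ)) y ∂μinf = p := integral_indicator_one hξ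
    linarith
  set M : ℝ := (H : ℝ) / tstar with hM
  have hM0 : 0 < M := div_pos hH0 hdR
  set L := Real.log (4 * H / (tstar * δ)) with hL
  have hδ0 : 0 < (tstar : ℝ) * δ := mul_pos hdR hδ.1
  have hL0 : 0 ≤ L := by
    refine Real.log_nonneg ((one_le_div hδ0).2 ?_)
    nlinarith [hδ.2]
  have hexpL : Real.exp (-L) ≤ δ / 2 := by
    rw [Real.exp_neg, hL, Real.exp_log (by positivity), inv_div, div_le_div_iff₀ (by positivity)
      two_pos]
    nlinarith [hδ.1]
  set e := Real.sqrt (M * L) with he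
  have he2 : e ^ 2 = M * L := Real.sq_sqrt (by positivity)
  have he0 : 0 ≤ e := Real.sqrt_nonneg _
  obtain ⟨m, hmH, hHm⟩ : ∃ m : ℕ, m * tstar < H ∧ H ≤ (m + 1) * tstar := by
    refine ⟨(H - 1) / tstar, ?_, ?_⟩
    · have := Nat.div_mul_le_self (H - 1) tstar
      omega
    · have h1 := Nat.div_add_mod' (H - 1) tstar
      have h2 := Nat.mod_lt (H - 1) hd
      rw [Nat.add_mul, Nat.one_mul]
      omega
  have hmM : (m : ℝ) ≤ M := by
    rw [hM, le_div_iff₀ hdR]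
    exact_mod_cast hmH.le
  have hMm : M ≤ m + 1 := by
    rw [hM, div_le_iff₀ hdR]
    exact_mod_cast hHm
  set l := 2 * e / M with hl
  have hl0 : 0 ≤ l := by positivity
  set N : Ω → ℝ := fun ω => ∑ k ∈ Finset.range m,
    ξ.indicator (fun _ => (1 : ℝ)) (X ((k + 1) * tstar) ω) with hN
  have hNmeas : Measurable N := Finset.measurable_fun_sum _ fun k _ => hf.comp (hXmeas _)
  have hmgf : ∫ ω, Real.exp (-l * N ω) ∂μ ≤ (1 - p / 2 * (1 - Real.exp (-l))) ^ m :=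
    integral_exp_neg_visits_le hκm hκp hXmeas hMarkov hξ (by linarith) hvisit hl0 m
  have hmarkov : Real.exp (-(l * (m * (p / 2) - e))) *
      μ.real {ω | Real.exp (-(l * (m * (p / 2) - e))) ≤ Real.exp (-l * N ω)}
        ≤ ∫ ω, Real.exp (-l * N ω) ∂μ := by
    refine mul_meas_ge_le_integral_of_nonneg (.of_forall fun ω => (Real.exp_pos _).le) ?_ _
    refine integrable_of_mem_Icc (Real.measurable_exp.comp (hNmeas.const_mul _)) fun ω => ?_
    refine ⟨(Real.exp_pos _).le, Real.exp_le_one_iff.2 ?_⟩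
    have : 0 ≤ N ω := Finset.sum_nonneg fun k _ => (hf01 _).1
    nlinarith
  have hbad : μ.real {ω | Real.exp (-(l * (m * (p / 2) - e))) ≤ Real.exp (-l * N ω)}
      ≤ δ / 2 := by
    refine le_trans ?_ ((chernoff_exponent_le (q := p / 2) ⟨by linarith, by linarith⟩ hM0 he2 he0
      hmM).trans hexpL)
    have h := mul_le_mul_of_nonneg_right (hmarkov.trans hmgf)
      (Real.exp_pos (l * (m * (p / 2) - e))).le
    rwa [mul_right_comm, ← Real.exp_add, neg_add_cancel, Real.exp_zero, one_mul] at h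
  set A := {ω | (H : ℝ) * p / (2 * tstar) - e - 1 ≤
          ∑ t ∈ Finset.range H, Set.indicator ξ (fun _ => (1 : ℝ)) (X t ω)} with hA
  have hAmeas : MeasurableSet A := measurableSet_le measurable_const
    (Finset.measurable_fun_sum _ fun t _ => hf.comp (hXmeas t))
  have hcompl : μ.real Aᶜ ≤ δ / 2 := by
    refine (measureReal_mono fun ω hω => ?_).trans hbad
    have h1 : ∑ t ∈ Finset.range H, ξ.indicator (fun _ => (1 : ℝ)) (X t ω)
        < (H : ℝ) * p / (2 * tstar) - e - 1 := not_le.1 hω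
    have h2 : N ω ≤ ∑ t ∈ Finset.range H, ξ.indicator (fun _ => (1 : ℝ)) (X t ω) :=
      sum_multiples_le_sum_range (f := fun t => ξ.indicator (fun _ => (1 : ℝ)) (X t ω))
        (fun t => (hf01 _).1) hd hmH
    have h3 : (H : ℝ) * p / (2 * tstar) = M * (p / 2) := by
      rw [hM]
      field_simp
    have h4 : N ω ≤ m * (p / 2) - e := by nlinarith
    refine Real.exp_le_exp.2 ?_
    nlinarith
  refine ENNReal.ofReal_le_of_le_toReal ?_
  have h := probReal_compl_eq_one_sub (μ := μ) hAmeas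
  rw [measureReal_def μ A] at h
  linarith
end
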